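/- The sequent calculus G4CK has the uniform interpolation property: for every sequent Γ ⇒ δ and every propositional variable p there exist formulas E_p(Γ) and A_p(Γ ⇒ δ) such that (1) vars(E_p(Γ)) ⊆ vars(Γ)\{p} and vars(A_p(Γ ⇒ δ)) ⊆ vars(Γ,δ)\{p}; (2) ⊢_G4CK Γ ⇒ E_p(Γ) and ⊢_G4CK Γ, A_p(Γ ⇒ δ) ⇒ δ; and (3) for every finite multiset Π with p ∉ vars(Π), if ⊢_G4CK Π, Γ ⇒ δ then ⊢_G4CK Π, E_p(Γ) ⇒ δ whenever p ∉ vars(δ), and ⊢_G4CK Π, E_p(Γ) ⇒ A_p(Γ ⇒ δ). -/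

import Mathlib

/-- Formulas of the modal language: φ ::= p | ⊥ | φ∧φ | φ∨φ | φ→φ | □φ | ◇φ. -/
inductive Form : Type
  | var : ℕ → Form
  | bot : Form
  | and : Form → Form → Form
  | or  : Form → Form → Form
  | imp : Form → Form → Form
  | box : Form → Form
  | dia : Form → Form
  deriving DecidableEq

/-- Helper for □⁻¹: remove an outer box. -/
def unboxF : Form → Option Form
  | Form.box φ => some φ
  | _ => none

/-- □⁻¹Γ := {φ | □φ ∈ Γ}, as a multiset operation. -/
def boxInv (Γ : Multiset Form) : Multiset Form := Γ.filterMap unboxF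

/-- ◇⁻¹Δ for a succedent Δ with at most one formula (modelled by `Option`). -/
def diaInv : Option Form → Option Form
  | some (Form.dia φ) => some φ
  | _ => none

/-- Provability in the sequent calculus G4CK: sequents Γ ⇒ δ with a
multiset antecedent and a single-formula succedent. -/
inductive G4CK : Multiset Form → Form → Prop
  | botL (Γ δ) : G4CK (Form.bot ::ₘ Γ) δ
  | idP (Γ n) : G4CK (Form.var n ::ₘ Γ) (Form.var n)
  | andL (Γ φ ψ δ) : G4CK (φ ::ₘ ψ ::ₘ Γ) δ → G4CK (Form.and φ ψ ::ₘ Γ) δ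
  | andR (Γ φ ψ) : G4CK Γ φ → G4CK Γ ψ → G4CK Γ (Form.and φ ψ)
  | orL (Γ φ ψ δ) : G4CK (φ ::ₘ Γ) δ → G4CK (ψ ::ₘ Γ) δ → G4CK (Form.or φ ψ ::ₘ Γ) δ
  | orR1 (Γ φ ψ) : G4CK Γ φ → G4CK Γ (Form.or φ ψ)
  | orR2 (Γ φ ψ) : G4CK Γ ψ → G4CK Γ (Form.or φ ψ)
  | impR (Γ φ ψ) : G4CK (φ ::ₘ Γ) ψ → G4CK Γ (Form.imp φ ψ)
  | andImpL (Γ φ ψ χ δ) :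
      G4CK (Form.imp φ (Form.imp ψ χ) ::ₘ Γ) δ →
      G4CK (Form.imp (Form.and φ ψ) χ ::ₘ Γ) δ
  | orImpL (Γ φ ψ χ δ) :
      G4CK (Form.imp φ χ ::ₘ Form.imp ψ χ ::ₘ Γ) δ →
      G4CK (Form.imp (Form.or φ ψ) χ ::ₘ Γ) δ
  | pImpL (Γ n φ δ) :
      G4CK (Form.var n ::ₘ φ ::ₘ Γ) δ →
      G4CK (Form.var n ::ₘ Form.imp (Form.var n) φ ::ₘ Γ) δ
  | impImpL (Γ φ ψ χ δ) :
      G4CK (Form.imp ψ χ ::ₘ Γ) (Form.imp φ ψ) → G4CK (χ ::ₘ Γ) δ →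
      G4CK (Form.imp (Form.imp φ ψ) χ ::ₘ Γ) δ
  | boxR (Γ φ) : G4CK (boxInv Γ) φ → G4CK Γ (Form.box φ)
  | boxImpL (Γ φ ψ δ) :
      G4CK (boxInv Γ) φ → G4CK (ψ ::ₘ Γ) δ →
      G4CK (Form.imp (Form.box φ) ψ ::ₘ Γ) δ
  | diaImpL (Γ γ φ ψ δ) :
      G4CK (γ ::ₘ boxInv Γ) φ → G4CK (ψ ::ₘ Form.dia γ ::ₘ Γ) δ →
      G4CK (Form.imp (Form.dia φ) ψ ::ₘ Form.dia γ ::ₘ Γ) δ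
  | diaL (Γ φ ψ) : G4CK (φ ::ₘ boxInv Γ) ψ → G4CK (Form.dia φ ::ₘ Γ) (Form.dia ψ)

/-- Provability in the sequent calculus G4WK: sequents Γ ⇒ Δ with a
multiset antecedent and a succedent with at most one formula (`Option Form`). -/
inductive G4WK : Multiset Form → Option Form → Prop
  | botL (Γ Δ) : G4WK (Form.bot ::ₘ Γ) Δ
  | idP (Γ n) : G4WK (Form.var n ::ₘ Γ) (some (Form.var n))
  | andL (Γ φ ψ Δ) : G4WK (φ ::ₘ ψ ::ₘ Γ) Δ → G4WK (Form.and φ ψ ::ₘ Γ) Δ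
  | andR (Γ φ ψ) : G4WK Γ (some φ) → G4WK Γ (some ψ) → G4WK Γ (some (Form.and φ ψ))
  | orL (Γ φ ψ Δ) : G4WK (φ ::ₘ Γ) Δ → G4WK (ψ ::ₘ Γ) Δ → G4WK (Form.or φ ψ ::ₘ Γ) Δ
  | orR1 (Γ φ ψ) : G4WK Γ (some φ) → G4WK Γ (some (Form.or φ ψ))
  | orR2 (Γ φ ψ) : G4WK Γ (some ψ) → G4WK Γ (some (Form.or φ ψ))
  | impR (Γ φ ψ) : G4WK (φ ::ₘ Γ) (some ψ) → G4WK Γ (some (Form.imp φ ψ))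
  | andImpL (Γ φ ψ χ Δ) :
      G4WK (Form.imp φ (Form.imp ψ χ) ::ₘ Γ) Δ →
      G4WK (Form.imp (Form.and φ ψ) χ ::ₘ Γ) Δ
  | orImpL (Γ φ ψ χ Δ) :
      G4WK (Form.imp φ χ ::ₘ Form.imp ψ χ ::ₘ Γ) Δ →
      G4WK (Form.imp (Form.or φ ψ) χ ::ₘ Γ) Δ
  | pImpL (Γ n φ Δ) :
      G4WK (Form.var n ::ₘ φ ::ₘ Γ) Δ →
      G4WK (Form.var n ::ₘ Form.imp (Form.var n) φ ::ₘ Γ) Δ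
  | impImpL (Γ φ ψ χ Δ) :
      G4WK (Form.imp ψ χ ::ₘ Γ) (some (Form.imp φ ψ)) → G4WK (χ ::ₘ Γ) Δ →
      G4WK (Form.imp (Form.imp φ ψ) χ ::ₘ Γ) Δ
  | boxR (Γ φ) : G4WK (boxInv Γ) (some φ) → G4WK Γ (some (Form.box φ))
  | boxImpL (Γ φ ψ Δ) :
      G4WK (boxInv Γ) (some φ) → G4WK (ψ ::ₘ Γ) Δ →
      G4WK (Form.imp (Form.box φ) ψ ::ₘ Γ) Δ
  | diaImpL (Γ γ φ ψ Δ) :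
      G4WK (γ ::ₘ boxInv Γ) (some φ) → G4WK (ψ ::ₘ Form.dia γ ::ₘ Γ) Δ →
      G4WK (Form.imp (Form.dia φ) ψ ::ₘ Form.dia γ ::ₘ Γ) Δ
  | diaL' (Γ φ Δ) : G4WK (φ ::ₘ boxInv Γ) (diaInv Δ) → G4WK (Form.dia φ ::ₘ Γ) Δ

/-- Axiom schemes of the generalised Hilbert calculus CKH:
intuitionistic axioms A1–A9 together with K_□ and K_◇. -/
inductive CKAx : Form → Prop
  | a1 (φ ψ : Form) : CKAx (φ.imp (ψ.imp φ))
  | a2 (φ ψ χ : Form) : CKAx ((φ.imp (ψ.imp χ)).imp ((φ.imp ψ).imp (φ.imp χ)))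
  | a3 (φ ψ : Form) : CKAx (φ.imp (φ.or ψ))
  | a4 (φ ψ : Form) : CKAx (ψ.imp (φ.or ψ))
  | a5 (φ ψ χ : Form) : CKAx ((φ.imp χ).imp ((ψ.imp χ).imp ((φ.or ψ).imp χ)))
  | a6 (φ ψ : Form) : CKAx ((φ.and ψ).imp φ)
  | a7 (φ ψ : Form) : CKAx ((φ.and ψ).imp ψ)
  | a8 (φ ψ χ : Form) : CKAx ((φ.imp ψ).imp ((φ.imp χ).imp (φ.imp (ψ.and χ))))
  | a9 (φ : Form) : CKAx (Form.bot.imp φ)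
  | kbox (φ ψ : Form) : CKAx ((φ.imp ψ).box.imp (φ.box.imp ψ.box))
  | kdia (φ ψ : Form) : CKAx ((φ.imp ψ).box.imp (φ.dia.imp ψ.dia))

/-- Axiom schemes of WKH: those of CKH together with N : ¬◇⊥. -/
inductive WKAx : Form → Prop
  | ck {φ : Form} : CKAx φ → WKAx φ
  | n : WKAx (Form.bot.dia.imp Form.bot)

/-- Derivability Γ ⊢ φ in the generalised Hilbert calculus CKH. -/
inductive CKH : Set Form → Form → Prop
  | ax {Γ : Set Form} {φ : Form} : CKAx φ → CKH Γ φ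
  | el {Γ : Set Form} {φ : Form} : φ ∈ Γ → CKH Γ φ
  | mp {Γ : Set Form} {φ ψ : Form} : CKH Γ φ → CKH Γ (φ.imp ψ) → CKH Γ ψ
  | nec {Γ : Set Form} {φ : Form} : CKH ∅ φ → CKH Γ φ.box

/-- Derivability Γ ⊢ φ in the generalised Hilbert calculus WKH. -/
inductive WKH : Set Form → Form → Prop
  | ax {Γ : Set Form} {φ : Form} : WKAx φ → WKH Γ φ
  | el {Γ : Set Form} {φ : Form} : φ ∈ Γ → WKH Γ φ
  | mp {Γ : Set Form} {φ ψ : Form} : WKH Γ φ → WKH Γ (φ.imp ψ) → WKH Γ ψ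
  | nec {Γ : Set Form} {φ : Form} : WKH ∅ φ → WKH Γ φ.box

/-- The set of propositional variables occurring in a formula. -/
def vars : Form → Set ℕ
  | .var n => {n}
  | .bot => ∅
  | .and φ ψ => vars φ ∪ vars ψ
  | .or φ ψ => vars φ ∪ vars ψ
  | .imp φ ψ => vars φ ∪ vars ψ
  | .box φ => vars φ
  | .dia φ => vars φ

/-- Variables occurring in a multiset of formulas. -/
def varsM (Γ : Multiset Form) : Set ℕ := {n | ∃ φ ∈ Γ, n ∈ vars φ}

/-- Variables occurring in a succedent with at most one formula. -/
def varsO : Option Form → Set ℕ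
  | none => ∅
  | some φ => vars φ

@[simp] theorem boxInv_zero : boxInv 0 = 0 := rfl

@[simp] theorem boxInv_add (Γ Δ : Multiset Form) : boxInv (Γ + Δ) = boxInv Γ + boxInv Δ :=
  Multiset.filterMap_add _ _ _

@[simp] theorem boxInv_cons_var (n : ℕ) (Γ) : boxInv (Form.var n ::ₘ Γ) = boxInv Γ :=
  Multiset.filterMap_cons_none _ _ rfl
@[simp] theorem boxInv_cons_bot (Γ) : boxInv (Form.bot ::ₘ Γ) = boxInv Γ :=
  Multiset.filterMap_cons_none _ _ rfl
@[simp] theorem boxInv_cons_and (φ ψ Γ) : boxInv (Form.and φ ψ ::ₘ Γ) = boxInv Γ :=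
  Multiset.filterMap_cons_none _ _ rfl
@[simp] theorem boxInv_cons_or (φ ψ Γ) : boxInv (Form.or φ ψ ::ₘ Γ) = boxInv Γ :=
  Multiset.filterMap_cons_none _ _ rfl
@[simp] theorem boxInv_cons_imp (φ ψ Γ) : boxInv (Form.imp φ ψ ::ₘ Γ) = boxInv Γ :=
  Multiset.filterMap_cons_none _ _ rfl
@[simp] theorem boxInv_cons_dia (φ Γ) : boxInv (Form.dia φ ::ₘ Γ) = boxInv Γ :=
  Multiset.filterMap_cons_none _ _ rfl
@[simp] theorem boxInv_cons_box (φ Γ) : boxInv (Form.box φ ::ₘ Γ) = φ ::ₘ boxInv Γ :=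
  Multiset.filterMap_cons_some _ _ _ rfl

namespace G4CK

theorem add_right {Γ : Multiset Form} {δ : Form} (h : G4CK Γ δ) (Δ : Multiset Form) :
    G4CK (Γ + Δ) δ := by
  induction h generalizing Δ with
  | botL Γ δ => simpa using botL _ _
  | idP Γ n => simpa using idP _ _
  | andL Γ φ ψ δ _ ih => simpa using andL _ _ _ _ (by simpa using ih Δ)
  | andR Γ φ ψ _ _ ih₁ ih₂ => exact andR _ _ _ (ih₁ Δ) (ih₂ Δ)
  | orL Γ φ ψ δ _ _ ih₁ ih₂ =>
    simpa using orL _ _ _ _ (by simpa using ih₁ Δ) (by simpa using ih₂ Δ)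
  | orR1 Γ φ ψ _ ih => exact orR1 _ _ _ (ih Δ)
  | orR2 Γ φ ψ _ ih => exact orR2 _ _ _ (ih Δ)
  | impR Γ φ ψ _ ih => exact impR _ _ _ (by simpa using ih Δ)
  | andImpL Γ φ ψ χ δ _ ih => simpa using andImpL _ _ _ _ _ (by simpa using ih Δ)
  | orImpL Γ φ ψ χ δ _ ih => simpa using orImpL _ _ _ _ _ (by simpa using ih Δ)
  | pImpL Γ n φ δ _ ih => simpa using pImpL _ _ _ _ (by simpa using ih Δ)
  | impImpL Γ φ ψ χ δ _ _ ih₁ ih₂ =>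
    simpa using impImpL _ _ _ _ _ (by simpa using ih₁ Δ) (by simpa using ih₂ Δ)
  | boxR Γ φ _ ih => exact boxR _ _ (by simpa using ih (boxInv Δ))
  | boxImpL Γ φ ψ δ _ _ ih₁ ih₂ =>
    simpa using boxImpL (Γ + Δ) φ ψ δ (by simpa using ih₁ (boxInv Δ)) (by simpa using ih₂ Δ)
  | diaImpL Γ γ φ ψ δ _ _ ih₁ ih₂ =>
    simpa using diaImpL (Γ + Δ) γ φ ψ δ (by simpa using ih₁ (boxInv Δ)) (by simpa using ih₂ Δ)
  | diaL Γ φ ψ _ ih => simpa using diaL (Γ + Δ) φ ψ (by simpa using ih (boxInv Δ))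

theorem mono {Γ Δ : Multiset Form} {δ : Form} (h : G4CK Γ δ) (hle : Γ ≤ Δ) : G4CK Δ δ := by
  obtain ⟨Θ, rfl⟩ := Multiset.le_iff_exists_add.1 hle
  exact h.add_right Θ

theorem weaken {Γ : Multiset Form} {δ : Form} (h : G4CK Γ δ) (φ : Form) : G4CK (φ ::ₘ Γ) δ :=
  h.mono (Multiset.le_cons_self _ _)

theorem swap {Γ : Multiset Form} {φ ψ δ : Form} (h : G4CK (φ ::ₘ ψ ::ₘ Γ) δ) :
    G4CK (ψ ::ₘ φ ::ₘ Γ) δ := by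
  rwa [Multiset.cons_swap]

theorem perm {Γ Δ : Multiset Form} {δ : Form} (h : G4CK Γ δ) (e : Γ = Δ) : G4CK Δ δ :=
  e ▸ h

theorem top_intro (Γ : Multiset Form) : G4CK Γ (Form.imp Form.bot Form.bot) :=
  impR _ _ _ (botL _ _)

theorem of_bot_mem {Γ : Multiset Form} (h : Form.bot ∈ Γ) (δ : Form) : G4CK Γ δ := by
  obtain ⟨Γ', rfl⟩ := Multiset.exists_cons_of_mem h
  exact botL _ _

theorem of_var_mem {Γ : Multiset Form} {n : ℕ} (h : Form.var n ∈ Γ) : G4CK Γ (Form.var n) := by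
  obtain ⟨Γ', rfl⟩ := Multiset.exists_cons_of_mem h
  exact idP _ _

/-- `LeftInv φ Δ` holds when an antecedent formula `φ` may be replaced by the formulas `Δ`
of a premise of the left rule with principal formula `φ`. -/
inductive LeftInv : Form → Multiset Form → Prop
  | and (φ ψ) : LeftInv (Form.and φ ψ) {φ, ψ}
  | orLeft (φ ψ) : LeftInv (Form.or φ ψ) {φ}
  | orRight (φ ψ) : LeftInv (Form.or φ ψ) {ψ}
  | andImp (φ ψ χ) : LeftInv (Form.imp (Form.and φ ψ) χ) {Form.imp φ (Form.imp ψ χ)}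
  | orImp (φ ψ χ) : LeftInv (Form.imp (Form.or φ ψ) χ) {Form.imp φ χ, Form.imp ψ χ}
  | varImp (n φ) : LeftInv (Form.imp (Form.var n) φ) {φ}
  | impImp (φ ψ χ) : LeftInv (Form.imp (Form.imp φ ψ) χ) {χ}
  | boxImp (φ ψ) : LeftInv (Form.imp (Form.box φ) ψ) {ψ}
  | diaImp (φ ψ) : LeftInv (Form.imp (Form.dia φ) ψ) {ψ}

theorem LeftInv.boxInv_cons {φ : Form} {Δ : Multiset Form} (h : LeftInv φ Δ)
    (Γ : Multiset Form) : boxInv (φ ::ₘ Γ) = boxInv Γ := by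
  cases h <;> simp

theorem LeftInv.invert {X : Form} {Y : Multiset Form} (hX : LeftInv X Y)
    {Γ : Multiset Form} {δ : Form} (h : G4CK (X ::ₘ Γ) δ) : G4CK (Y + Γ) δ := by
  generalize hS : X ::ₘ Γ = S at h
  induction h generalizing Γ with
  | botL Γ' δ =>
    exact of_bot_mem (Multiset.mem_add.2 <| .inr <| by
      rcases Multiset.cons_eq_cons.1 hS with ⟨rfl, -⟩ | ⟨-, G, rfl, -⟩
      · cases hX
      · simp) δ
  | idP Γ' n =>
    exact of_var_mem (Multiset.mem_add.2 <| .inr <| by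
      rcases Multiset.cons_eq_cons.1 hS with ⟨rfl, -⟩ | ⟨-, G, rfl, -⟩
      · cases hX
      · simp)
  | andL Γ' φ ψ δ h ih =>
    rcases Multiset.cons_eq_cons.1 hS with ⟨rfl, rfl⟩ | ⟨-, G, rfl, rfl⟩
    · cases hX
      simpa using h
    · simpa using andL _ _ _ _ (by simpa using ih (Γ := φ ::ₘ ψ ::ₘ G) (by
        simp only [← Multiset.singleton_add]; abel))
  | andR Γ' φ ψ _ _ ih₁ ih₂ => exact andR _ _ _ (ih₁ hS) (ih₂ hS)
  | orL Γ' φ ψ δ h₁ h₂ ih₁ ih₂ =>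
    rcases Multiset.cons_eq_cons.1 hS with ⟨rfl, rfl⟩ | ⟨-, G, rfl, rfl⟩
    · cases hX
      · simpa using h₁
      · simpa using h₂
    · simpa using orL _ _ _ _
        (by simpa using ih₁ (Γ := φ ::ₘ G) (Multiset.cons_swap _ _ _))
        (by simpa using ih₂ (Γ := ψ ::ₘ G) (Multiset.cons_swap _ _ _))
  | orR1 Γ' φ ψ _ ih => exact orR1 _ _ _ (ih hS)
  | orR2 Γ' φ ψ _ ih => exact orR2 _ _ _ (ih hS)
  | impR Γ' φ ψ _ ih =>
    subst hS
    exact impR _ _ _ (by simpa using ih (Γ := φ ::ₘ Γ) (Multiset.cons_swap _ _ _))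
  | andImpL Γ' φ ψ χ δ h ih =>
    rcases Multiset.cons_eq_cons.1 hS with ⟨rfl, rfl⟩ | ⟨-, G, rfl, rfl⟩
    · cases hX
      simpa using h
    · simpa using andImpL _ _ _ _ _ (by
        simpa using ih (Γ := φ.imp (ψ.imp χ) ::ₘ G) (Multiset.cons_swap _ _ _))
  | orImpL Γ' φ ψ χ δ h ih =>
    rcases Multiset.cons_eq_cons.1 hS with ⟨rfl, rfl⟩ | ⟨-, G, rfl, rfl⟩
    · cases hX
      simpa using h
    · simpa using orImpL _ _ _ _ _ (by
        simpa using ih (Γ := φ.imp χ ::ₘ ψ.imp χ ::ₘ G) (by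
          simp only [← Multiset.singleton_add]; abel))
  | pImpL Γ' n φ δ h ih =>
    rcases Multiset.cons_eq_cons.1 hS with ⟨rfl, -⟩ | ⟨-, G, rfl, hG⟩
    · cases hX
    · rcases Multiset.cons_eq_cons.1 hG with ⟨rfl, rfl⟩ | ⟨-, H, rfl, rfl⟩
      · cases hX
        exact h.swap
      · simpa using pImpL _ _ _ _ (by
          simpa using ih (Γ := Form.var n ::ₘ φ ::ₘ H) (by
            simp only [← Multiset.singleton_add]; abel))
  | impImpL Γ' φ ψ χ δ h₁ h₂ ih₁ ih₂ =>
    rcases Multiset.cons_eq_cons.1 hS with ⟨rfl, rfl⟩ | ⟨-, G, rfl, rfl⟩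
    · cases hX
      simpa using h₂
    · simpa using impImpL _ _ _ _ _
        (by simpa using ih₁ (Γ := ψ.imp χ ::ₘ G) (Multiset.cons_swap _ _ _))
        (by simpa using ih₂ (Γ := χ ::ₘ G) (Multiset.cons_swap _ _ _))
  | boxR Γ' φ h ih =>
    subst hS
    rw [hX.boxInv_cons] at h
    exact boxR _ _ (h.mono (by simp))
  | boxImpL Γ' φ ψ δ h₁ h₂ ih₁ ih₂ =>
    rcases Multiset.cons_eq_cons.1 hS with ⟨rfl, rfl⟩ | ⟨-, G, rfl, rfl⟩
    · cases hX
      simpa using h₂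
    · rw [hX.boxInv_cons] at h₁
      simpa using boxImpL (Y + G) φ ψ δ (h₁.mono (by simp))
        (by simpa using ih₂ (Γ := ψ ::ₘ G) (Multiset.cons_swap _ _ _))
  | diaImpL Γ' γ φ ψ δ h₁ h₂ ih₁ ih₂ =>
    rcases Multiset.cons_eq_cons.1 hS with ⟨rfl, rfl⟩ | ⟨-, G, rfl, hG⟩
    · cases hX
      exact h₂
    · rcases Multiset.cons_eq_cons.1 hG with ⟨rfl, -⟩ | ⟨-, H, rfl, rfl⟩
      · cases hX
      · rw [hX.boxInv_cons] at h₁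
        simpa using diaImpL (Y + H) γ φ ψ δ (h₁.mono (by simp))
          (by simpa using ih₂ (Γ := ψ ::ₘ Form.dia γ ::ₘ H) (by
            simp only [← Multiset.singleton_add]; abel))
  | diaL Γ' φ ψ h ih =>
    rcases Multiset.cons_eq_cons.1 hS with ⟨rfl, -⟩ | ⟨-, G, rfl, rfl⟩
    · cases hX
    · rw [hX.boxInv_cons] at h
      simpa using diaL (Y + G) φ ψ (h.mono (by simp))

theorem imp_left {Γ : Multiset Form} {φ ψ θ : Form} (h : G4CK Γ φ) (hψ : G4CK (ψ ::ₘ Γ) θ) :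
    G4CK (Form.imp φ ψ ::ₘ Γ) θ := by
  induction h generalizing ψ θ with
  | botL Γ δ => exact (botL _ _).swap
  | idP Γ n => exact (pImpL _ _ _ _ hψ.swap).swap
  | andL Γ a b δ _ ih =>
    have := ih (ψ := ψ) (((LeftInv.and a b).invert hψ.swap).perm (by
      simp only [← Multiset.singleton_add, Multiset.insert_eq_cons]; abel))
    exact (andL (Form.imp δ ψ ::ₘ Γ) a b θ (this.perm (by
      simp only [← Multiset.singleton_add]; abel))).swap
  | andR Γ a b _ _ ih₁ ih₂ => exact andImpL _ _ _ _ _ (ih₁ (ih₂ hψ))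
  | orL Γ a b δ _ _ ih₁ ih₂ =>
    exact (orL _ _ _ _
      (ih₁ (by simpa using ((LeftInv.orLeft a b).invert hψ.swap).swap)).swap
      (ih₂ (by simpa using ((LeftInv.orRight a b).invert hψ.swap).swap)).swap).swap
  | orR1 Γ a b _ ih => exact orImpL _ _ _ _ _ ((ih hψ).weaken _).swap
  | orR2 Γ a b _ ih => exact orImpL _ _ _ _ _ ((ih hψ).weaken _)
  | impR Γ a b h _ => exact impImpL _ _ _ _ _ ((impR _ _ _ h).weaken _) hψ
  | andImpL Γ a b c δ _ ih =>
    exact (andImpL _ _ _ _ _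
      (ih (by simpa using ((LeftInv.andImp a b c).invert hψ.swap).swap)).swap).swap
  | orImpL Γ a b c δ _ ih =>
    have := ih (ψ := ψ) (((LeftInv.orImp a b c).invert hψ.swap).perm (by
      simp only [← Multiset.singleton_add, Multiset.insert_eq_cons]; abel))
    exact (orImpL (Form.imp δ ψ ::ₘ Γ) a b c θ (this.perm (by
      simp only [← Multiset.singleton_add]; abel))).swap
  | pImpL Γ n a δ _ ih =>
    have h₁ : G4CK (Form.imp (Form.var n) a ::ₘ ψ ::ₘ Form.var n ::ₘ Γ) θ :=
      hψ.perm (by simp only [← Multiset.singleton_add]; abel)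
    have h₂ := ih (ψ := ψ) (((LeftInv.varImp n a).invert h₁).perm (by
      simp only [← Multiset.singleton_add]; abel))
    exact (pImpL (Form.imp δ ψ ::ₘ Γ) n a θ (h₂.perm (by
      simp only [← Multiset.singleton_add]; abel))).perm (by
        simp only [← Multiset.singleton_add]; abel)
  | impImpL Γ a b c δ h₁ _ _ ih₂ =>
    exact (impImpL _ _ _ _ _ (h₁.weaken _).swap
      (ih₂ (by simpa using ((LeftInv.impImp a b c).invert hψ.swap).swap)).swap).swap
  | boxR Γ a h _ => exact boxImpL _ _ _ _ h hψ
  | boxImpL Γ a b δ h₁ _ _ ih₂ =>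
    exact (boxImpL _ _ _ _ (by simpa using h₁)
      (ih₂ (by simpa using ((LeftInv.boxImp a b).invert hψ.swap).swap)).swap).swap
  | diaImpL Γ g a b δ h₁ _ _ ih₂ =>
    have h₂ := (ih₂ (by simpa using ((LeftInv.diaImp a b).invert hψ.swap).swap)).swap
    have h₃ := diaImpL (Form.imp δ ψ ::ₘ Γ) g a b θ (by simpa using h₁)
      (h₂.perm (by rw [Multiset.cons_swap (Form.imp _ ψ)]))
    exact h₃.perm (by simp only [← Multiset.singleton_add]; abel)
  | diaL Γ a b h _ => exact diaImpL _ _ _ _ _ h hψ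

end G4CK

namespace Form

abbrev top : Form := imp bot bot

def weight : Form → ℕ
  | var _ => 1
  | bot => 1
  | and φ ψ => weight φ + weight ψ + 2
  | or φ ψ => weight φ + weight ψ + 2
  | imp φ ψ => weight φ + weight ψ + 1
  | box φ => weight φ + 1
  | dia φ => weight φ + 1

theorem weight_pos (φ : Form) : 0 < φ.weight := by
  cases φ <;> simp [weight]

/-- An exponential size, for which every premise of a rule of `G4CK` is smaller than
its conclusion. -/
def size (φ : Form) : ℕ := 4 ^ φ.weight

theorem size_pos (φ : Form) : 0 < φ.size := Nat.pow_pos (by norm_num)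

theorem size_lt {φ ψ : Form} (h : φ.weight < ψ.weight) : φ.size < ψ.size :=
  Nat.pow_lt_pow_right (by norm_num) h

theorem size_add_lt {φ ψ χ : Form} (h₁ : φ.weight < χ.weight) (h₂ : ψ.weight < χ.weight) :
    φ.size + ψ.size < χ.size := by
  have key : ∀ a b c : ℕ, a < c → b < c → 4 ^ a + 4 ^ b < 4 ^ c := by
    intro a b c ha hb
    obtain ⟨d, rfl⟩ : ∃ d, c = d + 1 := ⟨c - 1, by omega⟩
    have h₁ : 4 ^ a ≤ 4 ^ d := Nat.pow_le_pow_right (by norm_num) (by omega)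
    have h₂ : 4 ^ b ≤ 4 ^ d := Nat.pow_le_pow_right (by norm_num) (by omega)
    have h₃ : 0 < 4 ^ d := Nat.pow_pos (by norm_num)
    rw [pow_succ]
    omega
  exact key _ _ _ h₁ h₂

theorem size_and (φ ψ : Form) : φ.size + ψ.size < (and φ ψ).size :=
  size_add_lt (by simp only [weight]; omega) (by simp only [weight]; omega)
theorem size_or (φ ψ : Form) : φ.size + ψ.size < (or φ ψ).size :=
  size_add_lt (by simp only [weight]; omega) (by simp only [weight]; omega)
theorem size_imp (φ ψ : Form) : φ.size + ψ.size < (imp φ ψ).size := by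
  have := weight_pos φ
  have := weight_pos ψ
  exact size_add_lt (by simp only [weight]; omega) (by simp only [weight]; omega)
theorem size_box (φ : Form) : φ.size < (box φ).size := size_lt (by simp only [weight]; omega)
theorem size_dia (φ : Form) : φ.size < (dia φ).size := size_lt (by simp only [weight]; omega)
theorem size_andImp (φ ψ χ : Form) :
    (imp φ (imp ψ χ)).size < (imp (and φ ψ) χ).size := size_lt (by simp only [weight]; omega)
theorem size_orImp (φ ψ χ : Form) :
    (imp φ χ).size + (imp ψ χ).size < (imp (or φ ψ) χ).size :=
  size_add_lt (by simp only [weight]; omega) (by simp only [weight]; omega)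
theorem size_impImp (φ ψ χ : Form) :
    (imp ψ χ).size + (imp φ ψ).size < (imp (imp φ ψ) χ).size := by
  have := weight_pos φ
  have := weight_pos χ
  exact size_add_lt (by simp only [weight]; omega) (by simp only [weight]; omega)

end Form

def undiaF : Form → Option Form
  | Form.dia φ => some φ
  | _ => none

/-- The multiset of all `φ` with `◇φ ∈ Γ`. -/
def diaPart (Γ : Multiset Form) : Multiset Form := Γ.filterMap undiaF

theorem mem_diaPart {φ : Form} {Γ : Multiset Form} : φ ∈ diaPart Γ ↔ Form.dia φ ∈ Γ := by
  simp only [diaPart, Multiset.mem_filterMap]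
  constructor
  · rintro ⟨ψ, hψ, h⟩
    cases ψ <;> simp [undiaF] at h
    exact h ▸ hψ
  · exact fun h => ⟨_, h, rfl⟩

theorem mem_boxInv {φ : Form} {Γ : Multiset Form} : φ ∈ boxInv Γ ↔ Form.box φ ∈ Γ := by
  simp only [boxInv, Multiset.mem_filterMap]
  constructor
  · rintro ⟨ψ, hψ, h⟩
    cases ψ <;> simp [unboxF] at h
    exact h ▸ hψ
  · exact fun h => ⟨_, h, rfl⟩

def msize (Γ : Multiset Form) : ℕ := (Γ.map Form.size).sum

@[simp] theorem msize_zero : msize 0 = 0 := rfl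

@[simp] theorem msize_cons (φ : Form) (Γ : Multiset Form) :
    msize (φ ::ₘ Γ) = φ.size + msize Γ := by
  simp [msize]

theorem msize_boxInv_le (Γ : Multiset Form) : msize (boxInv Γ) ≤ msize Γ := by
  induction Γ using Multiset.induction_on with
  | empty => simp
  | cons φ Γ ih =>
    cases φ with
    | box φ => have := φ.size_box; simp; omega
    | _ => simp; omega

theorem msize_boxInv_lt {Γ : Multiset Form} (h : Γ ≠ 0) : msize (boxInv Γ) < msize Γ := by
  obtain ⟨φ, hφ⟩ := Multiset.exists_mem_of_ne_zero h
  obtain ⟨Γ, rfl⟩ := Multiset.exists_cons_of_mem hφ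
  have := msize_boxInv_le Γ
  have := φ.size_pos
  cases φ with
  | box φ => have := φ.size_box; simp; omega
  | _ => simp; omega

theorem msize_boxInv_add_lt {Γ : Multiset Form} {φ : Form} (h : Form.dia φ ∈ Γ) :
    φ.size + msize (boxInv Γ) < msize Γ := by
  obtain ⟨Γ, rfl⟩ := Multiset.exists_cons_of_mem h
  have := msize_boxInv_le Γ
  have := φ.size_dia
  simp
  omega

noncomputable def bigAnd (M : Multiset Form) : Form := M.toList.foldr Form.and Form.top

noncomputable def bigOr (M : Multiset Form) : Form := M.toList.foldr Form.or Form.bot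

namespace UnifInterp

variable (p : ℕ) (E : Multiset Form → Form) (A : Multiset Form → Form → Form)

/-- The conjuncts of `E p (φ ::ₘ Γ)` contributed by `φ`. -/
noncomputable def eLeft (Γ : Multiset Form) : Form → Multiset Form
  | .bot => {.bot}
  | .var n => if n = p then 0 else {.var n}
  | .and φ ψ => {E (φ ::ₘ ψ ::ₘ Γ)}
  | .or φ ψ => {.or (E (φ ::ₘ Γ)) (E (ψ ::ₘ Γ))}
  | .box _ => 0
  | .dia φ => {.dia (E (φ ::ₘ boxInv Γ))}
  | .imp .bot _ => 0
  | .imp (.var n) φ =>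
    if n = p then (if Form.var p ∈ Γ then {E (φ ::ₘ Γ)} else 0)
    else {.imp (.var n) (E (φ ::ₘ Γ))}
  | .imp (.and φ ψ) χ => {E (φ.imp (ψ.imp χ) ::ₘ Γ)}
  | .imp (.or φ ψ) χ => {E (φ.imp χ ::ₘ ψ.imp χ ::ₘ Γ)}
  | .imp (.imp φ ψ) χ =>
    {.imp (.imp (E (ψ.imp χ ::ₘ Γ)) (A (ψ.imp χ ::ₘ Γ) (φ.imp ψ))) (E (χ ::ₘ Γ))}
  | .imp (.box φ) ψ =>
    {.imp (.box (.imp (E (boxInv Γ)) (A (boxInv Γ) φ))) (E (ψ ::ₘ Γ))}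
  | .imp (.dia φ) ψ =>
    .imp (.dia (.imp (E (boxInv Γ)) (A (boxInv Γ) φ))) (E (ψ ::ₘ Γ)) ::ₘ
      (diaPart Γ).map fun γ =>
        .imp (.box (.imp (E (γ ::ₘ boxInv Γ)) (A (γ ::ₘ boxInv Γ) φ))) (E (ψ ::ₘ Γ))

/-- The conjunct of `E p Γ` contributed by the boxed formulas of `Γ`. -/
def eBox (Γ : Multiset Form) : Multiset Form :=
  if Γ = 0 then 0 else {.box (E (boxInv Γ))}

noncomputable def conjuncts (Γ : Multiset Form) : Multiset Form :=
  eBox E Γ + Γ.bind fun φ => eLeft p E A (Γ.erase φ) φ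

/-- The disjuncts of `A p (φ ::ₘ Γ) δ` contributed by `φ`. -/
noncomputable def aLeft (Γ : Multiset Form) (δ : Form) : Form → Multiset Form
  | .bot => 0
  | .var _ => 0
  | .and φ ψ => {A (φ ::ₘ ψ ::ₘ Γ) δ}
  | .or φ ψ => {.and (.imp (E (φ ::ₘ Γ)) (A (φ ::ₘ Γ) δ)) (.imp (E (ψ ::ₘ Γ)) (A (ψ ::ₘ Γ) δ))}
  | .box _ => 0
  | .dia _ => 0
  | .imp .bot _ => 0
  | .imp (.var n) φ =>
    if n = p then (if Form.var p ∈ Γ then {A (φ ::ₘ Γ) δ} else 0)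
    else {.and (.var n) (A (φ ::ₘ Γ) δ)}
  | .imp (.and φ ψ) χ => {A (φ.imp (ψ.imp χ) ::ₘ Γ) δ}
  | .imp (.or φ ψ) χ => {A (φ.imp χ ::ₘ ψ.imp χ ::ₘ Γ) δ}
  | .imp (.imp φ ψ) χ =>
    {.and (.imp (E (ψ.imp χ ::ₘ Γ)) (A (ψ.imp χ ::ₘ Γ) (φ.imp ψ))) (A (χ ::ₘ Γ) δ)}
  | .imp (.box φ) ψ =>
    {.and (.box (.imp (E (boxInv Γ)) (A (boxInv Γ) φ))) (A (ψ ::ₘ Γ) δ)}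
  | .imp (.dia φ) ψ =>
    .and (.dia (.imp (E (boxInv Γ)) (A (boxInv Γ) φ))) (A (ψ ::ₘ Γ) δ) ::ₘ
      (diaPart Γ).map fun γ =>
        .and (.box (.imp (E (γ ::ₘ boxInv Γ)) (A (γ ::ₘ boxInv Γ) φ))) (A (ψ ::ₘ Γ) δ)

/-- The disjuncts of `A p Γ δ` contributed by `δ`. -/
noncomputable def aRight (Γ : Multiset Form) : Form → Multiset Form
  | .bot => 0
  | .var n => if n = p then (if Form.var p ∈ Γ then {.top} else 0) else {.var n}
  | .and φ ψ => {.and (A Γ φ) (A Γ ψ)}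
  | .or φ ψ => {A Γ φ, A Γ ψ}
  | .imp φ ψ => {.imp (E (φ ::ₘ Γ)) (A (φ ::ₘ Γ) ψ)}
  | .box φ => {.box (.imp (E (boxInv Γ)) (A (boxInv Γ) φ))}
  | .dia φ =>
    .dia (.imp (E (boxInv Γ)) (A (boxInv Γ) φ)) ::ₘ
      (diaPart Γ).map fun γ =>
        .box (.imp (E (γ ::ₘ boxInv Γ)) (A (γ ::ₘ boxInv Γ) φ))

noncomputable def disjuncts (Γ : Multiset Form) (δ : Form) : Multiset Form :=
  aRight p E A Γ δ + Γ.bind fun φ => aLeft p E A (Γ.erase φ) δ φ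

section congr

variable {p E A} {E' : Multiset Form → Form} {A' : Multiset Form → Form → Form} {N : ℕ}
  (hE : ∀ Γ, msize Γ < N → E Γ = E' Γ) (hA : ∀ Γ δ, msize Γ + δ.size < N → A Γ δ = A' Γ δ)
include hE hA

theorem eLeft_congr {Γ : Multiset Form} {φ : Form} (h : φ.size + msize Γ ≤ N) :
    eLeft p E A Γ φ = eLeft p E' A' Γ φ := by
  have hb := msize_boxInv_le Γ
  rcases φ with n | _ | ⟨φ, ψ⟩ | ⟨φ, ψ⟩ |
      ⟨⟨n⟩ | _ | ⟨φ, ψ⟩ | ⟨φ, ψ⟩ | ⟨φ, ψ⟩ | φ | φ, χ⟩ | φ | φ <;>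
    simp only [eLeft]
  · have := φ.size_and ψ
    rw [hE _ (by simp; omega)]
  · have := φ.size_or ψ
    rw [hE (φ ::ₘ Γ) (by simp; omega), hE (ψ ::ₘ Γ) (by simp; omega)]
  · have := (Form.var n).size_imp χ
    rw [hE _ (by simp; omega)]
  · have := φ.size_andImp ψ χ
    rw [hE _ (by simp; omega)]
  · have := φ.size_orImp ψ χ
    rw [hE _ (by simp; omega)]
  · have := φ.size_impImp ψ χ
    have := (φ.imp ψ).size_imp χ
    rw [hE (_ ::ₘ Γ) (by simp; omega), hE (χ ::ₘ Γ) (by simp; omega), hA _ _ (by simp; omega)]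
  · have := φ.size_box
    have := φ.box.size_imp χ
    rw [hE (boxInv Γ) (by omega), hE (χ ::ₘ Γ) (by simp; omega), hA _ _ (by omega)]
  · have := φ.size_dia
    have := φ.dia.size_imp χ
    rw [hE (boxInv Γ) (by omega), hE (χ ::ₘ Γ) (by simp; omega), hA _ _ (by omega)]
    congr 1
    refine Multiset.map_congr rfl fun γ hγ => ?_
    have := msize_boxInv_add_lt (mem_diaPart.1 hγ)
    rw [hE _ (by simp; omega), hA _ _ (by simp; omega)]
  · have := φ.size_dia
    rw [hE _ (by simp; omega)]

theorem aLeft_congr {Γ : Multiset Form} {φ δ : Form} (h : φ.size + msize Γ + δ.size ≤ N) :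
    aLeft p E A Γ δ φ = aLeft p E' A' Γ δ φ := by
  have hb := msize_boxInv_le Γ
  have hδ := δ.size_pos
  rcases φ with n | _ | ⟨φ, ψ⟩ | ⟨φ, ψ⟩ |
      ⟨⟨n⟩ | _ | ⟨φ, ψ⟩ | ⟨φ, ψ⟩ | ⟨φ, ψ⟩ | φ | φ, χ⟩ | φ | φ <;>
    simp only [aLeft]
  · have := φ.size_and ψ
    rw [hA _ _ (by simp; omega)]
  · have := φ.size_or ψ
    rw [hE (φ ::ₘ Γ) (by simp; omega), hE (ψ ::ₘ Γ) (by simp; omega),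
      hA (φ ::ₘ Γ) _ (by simp; omega), hA (ψ ::ₘ Γ) _ (by simp; omega)]
  · have := (Form.var n).size_imp χ
    rw [hA _ _ (by simp; omega)]
  · have := φ.size_andImp ψ χ
    rw [hA _ _ (by simp; omega)]
  · have := φ.size_orImp ψ χ
    rw [hA _ _ (by simp; omega)]
  · have := φ.size_impImp ψ χ
    have := (φ.imp ψ).size_imp χ
    rw [hE (_ ::ₘ Γ) (by simp; omega), hA (χ ::ₘ Γ) _ (by simp; omega), hA _ _ (by simp; omega)]
  · have := φ.size_box
    have := φ.box.size_imp χ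
    rw [hE (boxInv Γ) (by omega), hA (χ ::ₘ Γ) _ (by simp; omega), hA _ _ (by omega)]
  · have := φ.size_dia
    have := φ.dia.size_imp χ
    rw [hE (boxInv Γ) (by omega), hA (χ ::ₘ Γ) _ (by simp; omega), hA _ _ (by omega)]
    congr 1
    refine Multiset.map_congr rfl fun γ hγ => ?_
    have := msize_boxInv_add_lt (mem_diaPart.1 hγ)
    rw [hE _ (by simp; omega), hA (_ ::ₘ boxInv Γ) _ (by simp; omega)]

theorem aRight_congr {Γ : Multiset Form} {δ : Form} (h : msize Γ + δ.size ≤ N) :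
    aRight p E A Γ δ = aRight p E' A' Γ δ := by
  have hb := msize_boxInv_le Γ
  rcases δ with n | _ | ⟨φ, ψ⟩ | ⟨φ, ψ⟩ | ⟨φ, ψ⟩ | φ | φ <;>
    simp only [aRight]
  · have := φ.size_and ψ
    rw [hA _ _ (by omega), hA _ _ (by omega)]
  · have := φ.size_or ψ
    rw [hA _ φ (by omega), hA _ ψ (by omega)]
  · have := φ.size_imp ψ
    rw [hE _ (by simp; omega), hA _ _ (by simp; omega)]
  · have := φ.size_box
    rw [hE _ (by omega), hA _ _ (by omega)]
  · have := φ.size_dia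
    rw [hE _ (by omega), hA _ _ (by omega)]
    congr 1
    refine Multiset.map_congr rfl fun γ hγ => ?_
    have := msize_boxInv_add_lt (mem_diaPart.1 hγ)
    rw [hE _ (by simp; omega), hA _ _ (by simp; omega)]

theorem conjuncts_congr {Γ : Multiset Form} (h : msize Γ ≤ N) :
    conjuncts p E A Γ = conjuncts p E' A' Γ := by
  unfold conjuncts
  congr 1
  · by_cases h0 : Γ = 0
    · simp [eBox, h0]
    · have := msize_boxInv_lt h0
      simp only [eBox, h0, if_false]
      rw [hE _ (by omega)]
  · refine Multiset.bind_congr fun φ hφ => eLeft_congr hE hA ?_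
    rwa [← msize_cons, Multiset.cons_erase hφ]

theorem disjuncts_congr {Γ : Multiset Form} {δ : Form} (h : msize Γ + δ.size ≤ N) :
    disjuncts p E A Γ δ = disjuncts p E' A' Γ δ := by
  unfold disjuncts
  rw [aRight_congr hE hA h]
  congr 1
  refine Multiset.bind_congr fun φ hφ => aLeft_congr hE hA ?_
  rwa [← msize_cons, Multiset.cons_erase hφ]

end congr

/-- The size of a sequent, whose succedent may be missing. -/
def sequentSize (s : Multiset Form × Option Form) : ℕ := msize s.1 + s.2.elim 0 Form.size

/-- Both interpolants: `interp p (Γ, none)` is `E p Γ`, and `interp p (Γ, some δ)` is `A p Γ δ`. -/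
noncomputable def interp (s : Multiset Form × Option Form) : Form :=
  let rec' : Multiset Form × Option Form → Form := fun t =>
    if _h : sequentSize t < sequentSize s then interp t else t.2.elim .top fun _ => .bot
  match s.2 with
  | none => bigAnd (conjuncts p (fun Γ => rec' (Γ, none)) (fun Γ δ => rec' (Γ, some δ)) s.1)
  | some δ => bigOr (disjuncts p (fun Γ => rec' (Γ, none)) (fun Γ δ => rec' (Γ, some δ)) s.1 δ)
termination_by sequentSize s
decreasing_by exact _h

noncomputable def exInterp (Γ : Multiset Form) : Form := interp p (Γ, none)

noncomputable def allInterp (Γ : Multiset Form) (δ : Form) : Form := interp p (Γ, some δ)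

theorem exInterp_eq (Γ : Multiset Form) :
    exInterp p Γ = bigAnd (conjuncts p (exInterp p) (allInterp p) Γ) := by
  rw [exInterp, interp]
  refine congrArg bigAnd (conjuncts_congr (N := msize Γ) ?_ ?_ le_rfl)
  · intro Δ h
    exact dif_pos (by simpa [sequentSize] using h)
  · intro Δ δ h
    exact dif_pos (by simpa [sequentSize] using h)

theorem allInterp_eq (Γ : Multiset Form) (δ : Form) :
    allInterp p Γ δ = bigOr (disjuncts p (exInterp p) (allInterp p) Γ δ) := by
  rw [allInterp, interp]
  refine congrArg bigOr (disjuncts_congr (N := msize Γ + δ.size) ?_ ?_ le_rfl)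
  · intro Δ h
    exact dif_pos (by simpa [sequentSize] using h)
  · intro Δ δ h
    exact dif_pos (by simpa [sequentSize] using h)

end UnifInterp

theorem G4CK.bigAnd_right {Γ M : Multiset Form} (h : ∀ φ ∈ M, G4CK Γ φ) :
    G4CK Γ (bigAnd M) := by
  have key : ∀ l : List Form, (∀ φ ∈ l, G4CK Γ φ) → G4CK Γ (l.foldr Form.and Form.top) := by
    intro l hl
    induction l with
    | nil => exact G4CK.top_intro _
    | cons φ l ih =>
      exact G4CK.andR _ _ _ (hl _ (by simp)) (ih fun ψ hψ => hl _ (by simp [hψ]))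
  exact key _ (by simpa using h)

theorem G4CK.bigAnd_left_iff {M Θ : Multiset Form} {δ : Form} :
    G4CK (bigAnd M ::ₘ Θ) δ ↔ G4CK (M + Form.top ::ₘ Θ) δ := by
  have key : ∀ (l : List Form) (Θ : Multiset Form),
      G4CK (l.foldr Form.and Form.top ::ₘ Θ) δ ↔ G4CK ((l : Multiset Form) + Form.top ::ₘ Θ) δ := by
    intro l
    induction l with
    | nil => simp
    | cons φ l ih =>
      intro Θ
      have : G4CK ((φ :: l).foldr Form.and Form.top ::ₘ Θ) δ ↔
          G4CK (φ ::ₘ l.foldr Form.and Form.top ::ₘ Θ) δ :=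
        ⟨fun h => by simpa using (G4CK.LeftInv.and _ _).invert h, G4CK.andL _ _ _ _⟩
      rw [this, Multiset.cons_swap, ih, ← Multiset.cons_coe, Multiset.cons_swap Form.top,
        Multiset.add_cons, Multiset.cons_add]
  simpa [bigAnd] using key M.toList Θ

theorem G4CK.bigOr_left {M Γ : Multiset Form} {δ : Form} (h : ∀ φ ∈ M, G4CK (φ ::ₘ Γ) δ) :
    G4CK (bigOr M ::ₘ Γ) δ := by
  have key : ∀ l : List Form, (∀ φ ∈ l, G4CK (φ ::ₘ Γ) δ) →
      G4CK (l.foldr Form.or Form.bot ::ₘ Γ) δ := by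
    intro l hl
    induction l with
    | nil => exact G4CK.botL _ _
    | cons φ l ih =>
      exact G4CK.orL _ _ _ _ (hl _ (by simp)) (ih fun ψ hψ => hl _ (by simp [hψ]))
  exact key _ (by simpa using h)

theorem G4CK.bigOr_right {M Γ : Multiset Form} {φ : Form} (hφ : φ ∈ M) (h : G4CK Γ φ) :
    G4CK Γ (bigOr M) := by
  have key : ∀ l : List Form, φ ∈ l → G4CK Γ (l.foldr Form.or Form.bot) := by
    intro l hl
    induction l with
    | nil => simp at hl
    | cons ψ l ih =>
      rcases List.mem_cons.1 hl with rfl | hl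
      · exact G4CK.orR1 _ _ _ h
      · exact G4CK.orR2 _ _ _ (ih hl)
  exact key _ (by simpa using hφ)

theorem vars_bigAnd {M : Multiset Form} {n : ℕ} (h : n ∈ vars (bigAnd M)) :
    ∃ φ ∈ M, n ∈ vars φ := by
  have key : ∀ l : List Form, n ∈ vars (l.foldr Form.and Form.top) → ∃ φ ∈ l, n ∈ vars φ := by
    intro l hl
    induction l with
    | nil => simp [vars] at hl
    | cons φ l ih =>
      rcases hl with hl | hl
      · exact ⟨φ, by simp, hl⟩
      · obtain ⟨ψ, hψ, hn⟩ := ih hl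
        exact ⟨ψ, by simp [hψ], hn⟩
  simpa using key _ h

theorem vars_bigOr {M : Multiset Form} {n : ℕ} (h : n ∈ vars (bigOr M)) :
    ∃ φ ∈ M, n ∈ vars φ := by
  have key : ∀ l : List Form, n ∈ vars (l.foldr Form.or Form.bot) → ∃ φ ∈ l, n ∈ vars φ := by
    intro l hl
    induction l with
    | nil => simp [vars] at hl
    | cons φ l ih =>
      rcases hl with hl | hl
      · exact ⟨φ, by simp, hl⟩
      · obtain ⟨ψ, hψ, hn⟩ := ih hl
        exact ⟨ψ, by simp [hψ], hn⟩
  simpa using key _ h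

@[simp] theorem varsM_cons (φ : Form) (Γ : Multiset Form) :
    varsM (φ ::ₘ Γ) = vars φ ∪ varsM Γ := by
  ext n
  simp [varsM]

theorem vars_subset_varsM {φ : Form} {Γ : Multiset Form} (h : φ ∈ Γ) : vars φ ⊆ varsM Γ :=
  fun _ hn => ⟨φ, h, hn⟩

theorem varsM_boxInv_subset (Γ : Multiset Form) : varsM (boxInv Γ) ⊆ varsM Γ := by
  rintro n ⟨φ, hφ, hn⟩
  exact ⟨_, mem_boxInv.1 hφ, hn⟩

theorem boxInv_singleton_box (φ : Form) : boxInv {Form.box φ} = {φ} := rfl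

theorem G4CK.of_count_le {Γ Δ : Multiset Form} {δ : Form} (h : G4CK Γ δ)
    (hle : ∀ φ, Γ.count φ ≤ Δ.count φ := by
      intro φ
      simp only [← Multiset.singleton_add, boxInv_add, boxInv_singleton_box, Multiset.count_add]
      omega) : G4CK Δ δ :=
  h.mono (Multiset.le_iff_count.2 hle)

namespace UnifInterp

/-- The variable condition and the implication part of uniform interpolation,
for a candidate interpolant `χ` of the sequent `s`. -/
def IsSound (p : ℕ) : Multiset Form × Option Form → Form → Prop
  | (Γ, none), χ => vars χ ⊆ varsM Γ \ {p} ∧ G4CK Γ χ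
  | (Γ, some δ), χ => vars χ ⊆ (varsM Γ ∪ vars δ) \ {p} ∧ G4CK (χ ::ₘ Γ) δ

section sound

variable {p : ℕ} {E : Multiset Form → Form} {A : Multiset Form → Form → Form}

section vars

variable {V : Set ℕ} (hE : ∀ Γ, varsM Γ ⊆ V → vars (E Γ) ⊆ V \ {p})
  (hA : ∀ Γ δ, varsM Γ ⊆ V → vars δ ⊆ V → vars (A Γ δ) ⊆ V \ {p})
include hE hA

theorem eLeft_vars {Γ : Multiset Form} {φ χ : Form} (hφ : vars φ ⊆ V) (hΓ : varsM Γ ⊆ V)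
    (hχ : χ ∈ eLeft p E A Γ φ) : vars χ ⊆ V \ {p} := by
  have hb := (varsM_boxInv_subset Γ).trans hΓ
  have hd : ∀ γ ∈ diaPart Γ, vars γ ⊆ V :=
    fun γ hγ => (vars_subset_varsM (mem_diaPart.1 hγ)).trans hΓ
  rcases φ with m | _ | ⟨φ, ψ⟩ | ⟨φ, ψ⟩ |
      ⟨⟨m⟩ | _ | ⟨φ, ψ⟩ | ⟨φ, ψ⟩ | ⟨φ, ψ⟩ | φ | φ, θ⟩ | φ | φ <;>
    simp only [eLeft] at hχ <;> (try split_ifs at hχ) <;>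
    simp only [Multiset.mem_singleton, Multiset.mem_cons, Multiset.mem_map,
      Multiset.notMem_zero] at hχ
  case imp.dia =>
    rcases hχ with rfl | ⟨γ, hγ, rfl⟩ <;> simp_all [vars]
  case imp.imp =>
    have := hA (ψ.imp θ ::ₘ Γ) (φ.imp ψ)
    subst hχ
    simp_all [vars]
  all_goals subst hχ; simp_all [vars, Set.insert_subset_iff]

theorem aLeft_vars {Γ : Multiset Form} {φ δ χ : Form} (hφ : vars φ ⊆ V) (hΓ : varsM Γ ⊆ V)
    (hδ : vars δ ⊆ V) (hχ : χ ∈ aLeft p E A Γ δ φ) : vars χ ⊆ V \ {p} := by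
  have hb := (varsM_boxInv_subset Γ).trans hΓ
  have hd : ∀ γ ∈ diaPart Γ, vars γ ⊆ V :=
    fun γ hγ => (vars_subset_varsM (mem_diaPart.1 hγ)).trans hΓ
  rcases φ with m | _ | ⟨φ, ψ⟩ | ⟨φ, ψ⟩ |
      ⟨⟨m⟩ | _ | ⟨φ, ψ⟩ | ⟨φ, ψ⟩ | ⟨φ, ψ⟩ | φ | φ, θ⟩ | φ | φ <;>
    simp only [aLeft] at hχ <;> (try split_ifs at hχ) <;>
    simp only [Multiset.mem_singleton, Multiset.mem_cons, Multiset.mem_map,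
      Multiset.notMem_zero] at hχ
  case imp.dia =>
    rcases hχ with rfl | ⟨γ, hγ, rfl⟩ <;> simp_all [vars]
  case imp.imp =>
    have := hA (ψ.imp θ ::ₘ Γ) (φ.imp ψ)
    subst hχ
    simp_all [vars]
  all_goals subst hχ; simp_all [vars, Set.insert_subset_iff]

theorem aRight_vars {Γ : Multiset Form} {δ χ : Form} (hΓ : varsM Γ ⊆ V)
    (hδ : vars δ ⊆ V) (hχ : χ ∈ aRight p E A Γ δ) : vars χ ⊆ V \ {p} := by
  have hb := (varsM_boxInv_subset Γ).trans hΓ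
  have hd : ∀ γ ∈ diaPart Γ, vars γ ⊆ V :=
    fun γ hγ => (vars_subset_varsM (mem_diaPart.1 hγ)).trans hΓ
  rcases δ with m | _ | ⟨φ, ψ⟩ | ⟨φ, ψ⟩ | ⟨φ, ψ⟩ | φ | φ <;>
    simp only [aRight] at hχ <;> (try split_ifs at hχ) <;>
    simp only [Multiset.mem_singleton, Multiset.mem_cons, Multiset.mem_map,
      Multiset.insert_eq_cons, Multiset.notMem_zero] at hχ
  case or => rcases hχ with rfl | rfl <;> simp_all [vars]
  case dia =>
    rcases hχ with rfl | ⟨γ, hγ, rfl⟩ <;> simp_all [vars]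
  all_goals subst hχ; simp_all [vars]

theorem conjuncts_vars {Γ : Multiset Form} {χ : Form} (hΓ : varsM Γ ⊆ V)
    (hχ : χ ∈ conjuncts p E A Γ) : vars χ ⊆ V \ {p} := by
  rcases Multiset.mem_add.1 hχ with h | h
  · simp only [eBox] at h
    split_ifs at h
    · simp at h
    · rw [Multiset.mem_singleton.1 h]
      exact hE _ ((varsM_boxInv_subset Γ).trans hΓ)
  · obtain ⟨φ, hφ, h⟩ := Multiset.mem_bind.1 h
    rw [← Multiset.cons_erase hφ, varsM_cons, Set.union_subset_iff] at hΓ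
    exact eLeft_vars hE hA hΓ.1 hΓ.2 h

theorem disjuncts_vars {Γ : Multiset Form} {δ χ : Form} (hΓ : varsM Γ ⊆ V) (hδ : vars δ ⊆ V)
    (hχ : χ ∈ disjuncts p E A Γ δ) : vars χ ⊆ V \ {p} := by
  rcases Multiset.mem_add.1 hχ with h | h
  · exact aRight_vars hE hA hΓ hδ h
  · obtain ⟨φ, hφ, h⟩ := Multiset.mem_bind.1 h
    rw [← Multiset.cons_erase hφ, varsM_cons, Set.union_subset_iff] at hΓ
    exact aLeft_vars hE hA hΓ.1 hΓ.2 hδ h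

end vars

section derivable

variable (hE : ∀ Γ, G4CK Γ (E Γ)) (hA : ∀ Γ δ, G4CK (A Γ δ ::ₘ Γ) δ)
include hE hA

theorem imp_interp_left (Γ : Multiset Form) (δ : Form) :
    G4CK ((E Γ).imp (A Γ δ) ::ₘ Γ) δ :=
  G4CK.imp_left (hE Γ) (hA Γ δ)

theorem eLeft_derivable {Γ : Multiset Form} {φ χ : Form} (hχ : χ ∈ eLeft p E A Γ φ) :
    G4CK (φ ::ₘ Γ) χ := by
  have hEA := imp_interp_left hE hA
  rcases φ with m | _ | ⟨φ, ψ⟩ | ⟨φ, ψ⟩ |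
      ⟨⟨m⟩ | _ | ⟨φ, ψ⟩ | ⟨φ, ψ⟩ | ⟨φ, ψ⟩ | φ | φ, θ⟩ | φ | φ <;>
    simp only [eLeft] at hχ <;> (try split_ifs at hχ) <;>
    simp only [Multiset.mem_singleton, Multiset.mem_cons, Multiset.mem_map,
      Multiset.notMem_zero] at hχ
  case neg => subst hχ; exact .idP _ _
  case bot => exact .botL _ _
  case and => subst hχ; exact .andL _ _ _ _ (hE _)
  case or => subst hχ; exact .orL _ _ _ _ (.orR1 _ _ _ (hE _)) (.orR2 _ _ _ (hE _))
  case pos hm hp =>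
    subst hχ hm
    obtain ⟨Γ, rfl⟩ := Multiset.exists_cons_of_mem hp
    exact (G4CK.pImpL _ _ _ _ (hE _).swap).swap
  case neg =>
    subst hχ
    exact .impR _ _ _ (.pImpL _ _ _ _ ((hE _).weaken _))
  case imp.and => subst hχ; exact .andImpL _ _ _ _ _ (hE _)
  case imp.or => subst hχ; exact .orImpL _ _ _ _ _ (hE _)
  case imp.imp =>
    subst hχ
    exact .impR _ _ _ (.swap (.impImpL _ _ _ _ _ (hEA _ _).swap ((hE _).weaken _).swap))
  case imp.box =>
    subst hχ
    refine .impR _ _ _ (.swap (.boxImpL _ _ _ _ ?_ ((hE _).weaken _).swap))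
    rw [boxInv_cons_box]
    exact hEA _ _
  case imp.dia =>
    rcases hχ with rfl | ⟨γ, hγ, rfl⟩
    · exact .impR _ _ _ (.swap (.diaImpL _ _ _ _ _ (hEA _ _) (((hE _).weaken _).swap)))
    · obtain ⟨Γ, rfl⟩ := Multiset.exists_cons_of_mem (mem_diaPart.1 hγ)
      refine .impR _ _ _ ?_
      generalize hX : (E (γ ::ₘ boxInv (γ.dia ::ₘ Γ))).imp _ = X
      have h₁ : G4CK (γ ::ₘ boxInv (X.box ::ₘ Γ)) φ := by
        rw [boxInv_cons_box, ← hX, boxInv_cons_dia]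
        exact (hEA _ _).swap
      have h₂ : G4CK (θ ::ₘ γ.dia ::ₘ X.box ::ₘ Γ) (E (θ ::ₘ γ.dia ::ₘ Γ)) :=
        (hE _).of_count_le
      exact (G4CK.diaImpL _ _ _ _ _ h₁ h₂).of_count_le
  case dia => subst hχ; exact .diaL _ _ _ (hE _)

theorem aLeft_derivable {Γ : Multiset Form} {φ δ χ : Form} (hχ : χ ∈ aLeft p E A Γ δ φ) :
    G4CK (χ ::ₘ φ ::ₘ Γ) δ := by
  have hEA := imp_interp_left hE hA
  rcases φ with m | _ | ⟨φ, ψ⟩ | ⟨φ, ψ⟩ |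
      ⟨⟨m⟩ | _ | ⟨φ, ψ⟩ | ⟨φ, ψ⟩ | ⟨φ, ψ⟩ | φ | φ, θ⟩ | φ | φ <;>
    simp only [aLeft] at hχ <;> (try split_ifs at hχ) <;>
    simp only [Multiset.mem_singleton, Multiset.mem_cons, Multiset.mem_map,
      Multiset.notMem_zero] at hχ
  case and =>
    subst hχ
    generalize hX : A _ δ = X
    have h₁ : G4CK (φ ::ₘ ψ ::ₘ X ::ₘ Γ) δ := (hX ▸ hA _ δ).of_count_le
    exact (G4CK.andL _ _ _ _ h₁).swap
  case or =>
    subst hχ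
    generalize h₁ : (E (φ ::ₘ Γ)).imp _ = X
    generalize h₂ : (E (ψ ::ₘ Γ)).imp _ = Y
    have h₁ : G4CK (φ ::ₘ X ::ₘ Y ::ₘ Γ) δ := (h₁ ▸ hEA (φ ::ₘ Γ) δ).of_count_le
    have h₂ : G4CK (ψ ::ₘ X ::ₘ Y ::ₘ Γ) δ := (h₂ ▸ hEA (ψ ::ₘ Γ) δ).of_count_le
    exact .andL _ _ _ _ ((G4CK.orL _ _ _ _ h₁ h₂).of_count_le)
  case pos hm hp =>
    subst hχ hm
    obtain ⟨Γ, rfl⟩ := Multiset.exists_cons_of_mem hp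
    generalize hX : A _ δ = X
    have h₁ : G4CK (Form.var m ::ₘ θ ::ₘ X ::ₘ Γ) δ := (hX ▸ hA _ δ).of_count_le
    exact (G4CK.pImpL _ _ _ _ h₁).of_count_le
  case neg =>
    subst hχ
    generalize hX : A _ δ = X
    have h₁ : G4CK (Form.var m ::ₘ θ ::ₘ X ::ₘ Γ) δ := (hX ▸ hA _ δ).of_count_le
    exact .andL _ _ _ _ ((G4CK.pImpL _ _ _ _ h₁).of_count_le)
  case imp.and => subst hχ; exact (G4CK.andImpL _ _ _ _ _ (hA _ _).swap).swap
  case imp.or =>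
    subst hχ
    generalize hX : A _ δ = X
    have h₁ : G4CK (φ.imp θ ::ₘ ψ.imp θ ::ₘ X ::ₘ Γ) δ := (hX ▸ hA _ δ).of_count_le
    exact (G4CK.orImpL _ _ _ _ _ h₁).swap
  case imp.imp =>
    subst hχ
    generalize h₁ : (E (ψ.imp θ ::ₘ Γ)).imp _ = X
    generalize h₂ : A (θ ::ₘ Γ) δ = Y
    have h₁ : G4CK (ψ.imp θ ::ₘ X ::ₘ Y ::ₘ Γ) (φ.imp ψ) := (h₁ ▸ hEA _ _).of_count_le
    have h₂ : G4CK (θ ::ₘ X ::ₘ Y ::ₘ Γ) δ := (h₂ ▸ hA (θ ::ₘ Γ) δ).of_count_le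
    exact .andL _ _ _ _ ((G4CK.impImpL _ _ _ _ _ h₁ h₂).of_count_le)
  case imp.box =>
    subst hχ
    generalize h₁ : (E (boxInv Γ)).imp _ = X
    generalize h₂ : A (θ ::ₘ Γ) δ = Y
    have h₁ : G4CK (boxInv (X.box ::ₘ Y ::ₘ Γ)) φ := (h₁ ▸ hEA _ _).of_count_le
    have h₂ : G4CK (θ ::ₘ X.box ::ₘ Y ::ₘ Γ) δ := (h₂ ▸ hA (θ ::ₘ Γ) δ).of_count_le
    exact .andL _ _ _ _ ((G4CK.boxImpL _ _ _ _ h₁ h₂).of_count_le)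
  case imp.dia =>
    rcases hχ with rfl | ⟨γ, hγ, rfl⟩
    · generalize h₁ : (E (boxInv Γ)).imp _ = X
      generalize h₂ : A (θ ::ₘ Γ) δ = Y
      have h₁ : G4CK (X ::ₘ boxInv (Y ::ₘ Γ)) φ := (h₁ ▸ hEA _ _).of_count_le
      have h₂ : G4CK (θ ::ₘ X.dia ::ₘ Y ::ₘ Γ) δ := (h₂ ▸ hA (θ ::ₘ Γ) δ).of_count_le
      exact .andL _ _ _ _ ((G4CK.diaImpL _ _ _ _ _ h₁ h₂).of_count_le)
    · obtain ⟨Γ, rfl⟩ := Multiset.exists_cons_of_mem (mem_diaPart.1 hγ)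
      rw [boxInv_cons_dia]
      generalize h₁ : (E (γ ::ₘ boxInv Γ)).imp _ = X
      generalize h₂ : A (θ ::ₘ γ.dia ::ₘ Γ) δ = Y
      have h₁ : G4CK (γ ::ₘ boxInv (X.box ::ₘ Y ::ₘ Γ)) φ := (h₁ ▸ hEA _ _).of_count_le
      have h₂ : G4CK (θ ::ₘ γ.dia ::ₘ X.box ::ₘ Y ::ₘ Γ) δ := (h₂ ▸ hA _ δ).of_count_le
      exact .andL _ _ _ _ ((G4CK.diaImpL _ _ _ _ _ h₁ h₂).of_count_le)

theorem aRight_derivable {Γ : Multiset Form} {δ χ : Form} (hχ : χ ∈ aRight p E A Γ δ) :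
    G4CK (χ ::ₘ Γ) δ := by
  have hEA := imp_interp_left hE hA
  rcases δ with m | _ | ⟨φ, ψ⟩ | ⟨φ, ψ⟩ | ⟨φ, ψ⟩ | φ | φ <;>
    simp only [aRight] at hχ <;> (try split_ifs at hχ) <;>
    simp only [Multiset.mem_singleton, Multiset.mem_cons, Multiset.mem_map,
      Multiset.insert_eq_cons, Multiset.notMem_zero] at hχ
  case pos hm hp => exact .of_var_mem (Multiset.mem_cons_of_mem (hm ▸ hp))
  case neg => subst hχ; exact .idP _ _
  case and =>
    subst hχ
    exact .andL _ _ _ _ (.andR _ _ _ (((hA _ _).weaken _).swap) ((hA _ _).weaken _))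
  case or =>
    rcases hχ with rfl | rfl
    · exact .orR1 _ _ _ (hA _ _)
    · exact .orR2 _ _ _ (hA _ _)
  case imp => subst hχ; exact .impR _ _ _ (hEA _ _).swap
  case box =>
    subst hχ
    refine .boxR _ _ ?_
    rw [boxInv_cons_box]
    exact hEA _ _
  case dia =>
    rcases hχ with rfl | ⟨γ, hγ, rfl⟩
    · exact .diaL _ _ _ (hEA _ _)
    · obtain ⟨Γ, rfl⟩ := Multiset.exists_cons_of_mem (mem_diaPart.1 hγ)
      refine (G4CK.diaL _ _ _ ?_).swap
      rw [boxInv_cons_box, boxInv_cons_dia]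
      exact (hEA _ _).swap

theorem conjuncts_derivable {Γ : Multiset Form} {χ : Form} (hχ : χ ∈ conjuncts p E A Γ) :
    G4CK Γ χ := by
  rcases Multiset.mem_add.1 hχ with h | h
  · simp only [eBox] at h
    split_ifs at h
    · simp at h
    · rw [Multiset.mem_singleton.1 h]
      exact .boxR _ _ (hE _)
  · obtain ⟨φ, hφ, h⟩ := Multiset.mem_bind.1 h
    exact (eLeft_derivable hE hA h).perm (Multiset.cons_erase hφ)

theorem disjuncts_derivable {Γ : Multiset Form} {δ χ : Form} (hχ : χ ∈ disjuncts p E A Γ δ) :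
    G4CK (χ ::ₘ Γ) δ := by
  rcases Multiset.mem_add.1 hχ with h | h
  · exact aRight_derivable hE hA h
  · obtain ⟨φ, hφ, h⟩ := Multiset.mem_bind.1 h
    exact (aLeft_derivable hE hA h).perm (congrArg _ (Multiset.cons_erase hφ))

end derivable

end sound

theorem isSound_interp (p : ℕ) (s : Multiset Form × Option Form) : IsSound p s (interp p s) := by
  induction h : sequentSize s using Nat.strong_induction_on generalizing s with
  | _ N ih =>
    subst h
    rw [interp]
    set rec' : Multiset Form × Option Form → Form := fun t =>
      if _h : sequentSize t < sequentSize s then interp p t else t.2.elim .top fun _ => .bot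
    have hrec : ∀ t, IsSound p t (rec' t) := by
      intro t
      by_cases ht : sequentSize t < sequentSize s
      · simpa only [rec', dif_pos ht] using ih _ ht t rfl
      · simp only [rec', dif_neg ht]
        rcases t with ⟨Γ, _ | δ⟩
        · exact ⟨by simp [vars], .top_intro _⟩
        · exact ⟨by simp [vars], .botL _ _⟩
    have hE (V : Set ℕ) (Γ : Multiset Form) (hΓ : varsM Γ ⊆ V) :
        vars (rec' (Γ, none)) ⊆ V \ {p} :=
      (hrec (Γ, none)).1.trans (Set.sdiff_subset_sdiff_left hΓ)
    have hA (V : Set ℕ) (Γ : Multiset Form) (δ : Form) (hΓ : varsM Γ ⊆ V) (hδ : vars δ ⊆ V) :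
        vars (rec' (Γ, some δ)) ⊆ V \ {p} :=
      (hrec (Γ, some δ)).1.trans (Set.sdiff_subset_sdiff_left (Set.union_subset hΓ hδ))
    have hE' (Γ) := (hrec (Γ, none)).2
    have hA' (Γ δ) := (hrec (Γ, some δ)).2
    rcases s with ⟨Γ, _ | δ⟩
    · refine ⟨fun n hn => ?_, .bigAnd_right fun χ hχ => conjuncts_derivable hE' hA' hχ⟩
      obtain ⟨χ, hχ, hn⟩ := vars_bigAnd hn
      exact conjuncts_vars (hE _) (hA _) subset_rfl hχ hn
    · refine ⟨fun n hn => ?_, .bigOr_left fun χ hχ => disjuncts_derivable hE' hA' hχ⟩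
      obtain ⟨χ, hχ, hn⟩ := vars_bigOr hn
      exact disjuncts_vars (hE _) (hA _) Set.subset_union_left Set.subset_union_right hχ hn

end UnifInterp

theorem Multiset.cons_eq_add {α : Type*} {a : α} {s t u : Multiset α} (h : a ::ₘ s = t + u) :
    (∃ t', t = a ::ₘ t' ∧ s = t' + u) ∨ ∃ u', u = a ::ₘ u' ∧ s = t + u' := by
  have ha : a ∈ t + u := h ▸ Multiset.mem_cons_self a s
  rcases Multiset.mem_add.1 ha with ha | ha <;> obtain ⟨v, rfl⟩ := Multiset.exists_cons_of_mem ha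
  · exact .inl ⟨v, rfl, by simpa using h⟩
  · exact .inr ⟨v, rfl, by simpa using h⟩

namespace UnifInterp

variable {p : ℕ} {Θ Θ' Γ Γ' : Multiset Form} {δ φ χ τ : Form}

theorem eLeft_le_conjuncts (Γ : Multiset Form) (φ : Form) :
    eLeft p (exInterp p) (allInterp p) Γ φ ≤
      conjuncts p (exInterp p) (allInterp p) (φ ::ₘ Γ) := by
  rw [conjuncts, Multiset.cons_bind, Multiset.erase_cons_head]
  exact (Multiset.le_add_right _ _).trans (Multiset.le_add_left _ _)

theorem aLeft_le_disjuncts (Γ : Multiset Form) (δ φ : Form) :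
    aLeft p (exInterp p) (allInterp p) Γ δ φ ≤
      disjuncts p (exInterp p) (allInterp p) (φ ::ₘ Γ) δ := by
  rw [disjuncts, Multiset.cons_bind, Multiset.erase_cons_head]
  exact (Multiset.le_add_right _ _).trans (Multiset.le_add_left _ _)

theorem mem_conjuncts_of_eLeft (h : χ ∈ eLeft p (exInterp p) (allInterp p) Γ φ) :
    χ ∈ conjuncts p (exInterp p) (allInterp p) (φ ::ₘ Γ) :=
  Multiset.mem_of_le (eLeft_le_conjuncts Γ φ) h

theorem mem_disjuncts_of_aLeft (h : χ ∈ aLeft p (exInterp p) (allInterp p) Γ δ φ) :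
    χ ∈ disjuncts p (exInterp p) (allInterp p) (φ ::ₘ Γ) δ :=
  Multiset.mem_of_le (aLeft_le_disjuncts Γ δ φ) h

theorem mem_disjuncts_of_aRight (h : χ ∈ aRight p (exInterp p) (allInterp p) Γ δ) :
    χ ∈ disjuncts p (exInterp p) (allInterp p) Γ δ :=
  Multiset.mem_add.2 (.inl h)

theorem exInterp_left_iff :
    G4CK (exInterp p Γ ::ₘ Θ) τ ↔
      G4CK (conjuncts p (exInterp p) (allInterp p) Γ + Form.top ::ₘ Θ) τ := by
  rw [exInterp_eq, G4CK.bigAnd_left_iff]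

theorem exInterp_left_of_le {M : Multiset Form}
    (hM : M ≤ conjuncts p (exInterp p) (allInterp p) Γ) (h : G4CK (M + Θ) τ) :
    G4CK (exInterp p Γ ::ₘ Θ) τ :=
  exInterp_left_iff.2 (h.mono (add_le_add hM (Multiset.le_cons_self _ _)))

theorem exInterp_left_of_mem (hχ : χ ∈ conjuncts p (exInterp p) (allInterp p) Γ)
    (h : G4CK (χ ::ₘ Θ) τ) : G4CK (exInterp p Γ ::ₘ Θ) τ :=
  exInterp_left_of_le (Multiset.singleton_le.2 hχ) (by simpa using h)

theorem allInterp_right_of_mem (hχ : χ ∈ disjuncts p (exInterp p) (allInterp p) Γ δ)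
    (h : G4CK Θ χ) : G4CK Θ (allInterp p Γ δ) := by
  rw [allInterp_eq]
  exact G4CK.bigOr_right hχ h

/-- The uniformity part of uniform interpolation for the sequent `Θ + Γ ⇒ δ`. -/
def Uniform (p : ℕ) (Θ Γ : Multiset Form) (δ : Form) : Prop :=
  (p ∉ vars δ → G4CK (exInterp p Γ ::ₘ Θ) δ) ∧ G4CK (exInterp p Γ ::ₘ Θ) (allInterp p Γ δ)

namespace Uniform

theorem imp_right (h : Uniform p Θ Γ δ) : G4CK Θ ((exInterp p Γ).imp (allInterp p Γ δ)) :=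
  .impR _ _ _ h.2

theorem map (h : Uniform p Θ Γ δ)
    (H : ∀ τ, G4CK (exInterp p Γ ::ₘ Θ) τ → G4CK (exInterp p Γ ::ₘ Θ') τ) :
    Uniform p Θ' Γ δ :=
  ⟨fun hδ => H _ (h.1 hδ), H _ h.2⟩

theorem of_mem (hE : exInterp p Γ' ∈ conjuncts p (exInterp p) (allInterp p) Γ)
    (hA : allInterp p Γ' δ ∈ disjuncts p (exInterp p) (allInterp p) Γ δ)
    (h : Uniform p Θ Γ' δ) : Uniform p Θ Γ δ :=
  ⟨fun hδ => exInterp_left_of_mem hE (h.1 hδ),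
    exInterp_left_of_mem hE (allInterp_right_of_mem hA h.2)⟩

theorem of_imp_mem (hE : χ.imp (exInterp p Γ') ∈ conjuncts p (exInterp p) (allInterp p) Γ)
    (hA : χ.and (allInterp p Γ' δ) ∈ disjuncts p (exInterp p) (allInterp p) Γ δ)
    (hχ : G4CK Θ χ) (h : Uniform p Θ Γ' δ) : Uniform p Θ Γ δ :=
  ⟨fun hδ => exInterp_left_of_mem hE (G4CK.imp_left hχ (h.1 hδ)),
    allInterp_right_of_mem hA (.andR _ _ _ (hχ.weaken _)
      (exInterp_left_of_mem hE (G4CK.imp_left hχ h.2)))⟩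

end Uniform

theorem conjuncts_boxInv_left (h : G4CK (Θ + boxInv Γ) δ)
    (hE : G4CK (exInterp p (boxInv Γ) ::ₘ Θ) δ) :
    G4CK (Θ + boxInv (conjuncts p (exInterp p) (allInterp p) Γ)) δ := by
  by_cases hΓ : Γ = 0
  · subst hΓ
    exact h.mono (by simp)
  · refine hE.mono ?_
    simp only [conjuncts, eBox, if_neg hΓ, boxInv_add, boxInv_singleton_box]
    rw [← Multiset.singleton_add, add_comm]
    exact add_le_add le_rfl (Multiset.le_add_right _ _)

theorem uniform_of_derivable {S : Multiset Form} (h : G4CK S δ) (hS : S = Θ + Γ)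
    (hp : p ∉ varsM Θ) : Uniform p Θ Γ δ := by
  have hb (Θ : Multiset Form) (hp : p ∉ varsM Θ) : p ∉ varsM (boxInv Θ) :=
    fun h => hp (varsM_boxInv_subset Θ h)
  induction h generalizing Θ Γ with
  | botL S δ =>
    rcases Multiset.cons_eq_add hS with ⟨Θ, rfl, rfl⟩ | ⟨Γ, rfl, rfl⟩
    · exact ⟨fun _ => .of_bot_mem (by simp) _, .of_bot_mem (by simp) _⟩
    · have hE := mem_conjuncts_of_eLeft (p := p) (φ := .bot) (Γ := Γ)
        (Multiset.mem_singleton_self Form.bot)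
      exact ⟨fun _ => exInterp_left_of_mem hE (.botL _ _), exInterp_left_of_mem hE (.botL _ _)⟩
  | idP S n =>
    rcases Multiset.cons_eq_add hS with ⟨Θ, rfl, rfl⟩ | ⟨Γ, rfl, rfl⟩
    · have hn : n ≠ p := by rintro rfl; simp [vars] at hp
      exact ⟨fun _ => .of_var_mem (by simp), allInterp_right_of_mem (χ := .var n)
        (mem_disjuncts_of_aRight (by simp [aRight, hn])) (.of_var_mem (by simp))⟩
    · by_cases hn : n = p
      · subst hn
        exact ⟨fun h => absurd (by simp [vars]) h, allInterp_right_of_mem (χ := .top)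
          (mem_disjuncts_of_aRight (by simp [aRight])) (.top_intro _)⟩
      · have hE : G4CK (exInterp p (Form.var n ::ₘ Γ) ::ₘ Θ) (Form.var n) :=
          exInterp_left_of_mem (mem_conjuncts_of_eLeft (χ := .var n) (by simp [eLeft, hn]))
            (.idP _ _)
        exact ⟨fun _ => hE, allInterp_right_of_mem (mem_disjuncts_of_aRight (by simp [aRight, hn]))
          hE⟩
  | andL S φ ψ δ _ ih =>
    rcases Multiset.cons_eq_add hS with ⟨Θ, rfl, rfl⟩ | ⟨Γ, rfl, rfl⟩
    · refine (ih (Θ := φ ::ₘ ψ ::ₘ Θ) (Γ := Γ) (by simp) (by simp_all [vars])).map fun τ h => ?_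
      exact (G4CK.andL (exInterp p Γ ::ₘ Θ) φ ψ τ h.of_count_le).swap
    · exact (ih (Γ := φ ::ₘ ψ ::ₘ Γ) (by simp) hp).of_mem
        (mem_conjuncts_of_eLeft (by simp [eLeft])) (mem_disjuncts_of_aLeft (by simp [aLeft]))
  | andR S φ ψ _ _ ih₁ ih₂ =>
    refine ⟨fun h => ?_, allInterp_right_of_mem (mem_disjuncts_of_aRight (by simp [aRight]))
      (.andR _ _ _ (ih₁ hS hp).2 (ih₂ hS hp).2)⟩
    simp only [vars, Set.mem_union, not_or] at h
    exact .andR _ _ _ ((ih₁ hS hp).1 h.1) ((ih₂ hS hp).1 h.2)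
  | orL S φ ψ δ _ _ ih₁ ih₂ =>
    rcases Multiset.cons_eq_add hS with ⟨Θ, rfl, rfl⟩ | ⟨Γ, rfl, rfl⟩
    · have h₁ := ih₁ (Θ := φ ::ₘ Θ) (Γ := Γ) (by simp) (by simp_all [vars])
      have h₂ := ih₂ (Θ := ψ ::ₘ Θ) (Γ := Γ) (by simp) (by simp_all [vars])
      exact ⟨fun hδ => (G4CK.orL _ _ _ _ (h₁.1 hδ).swap (h₂.1 hδ).swap).swap,
        (G4CK.orL _ _ _ _ h₁.2.swap h₂.2.swap).swap⟩
    · have h₁ := ih₁ (Θ := Θ) (Γ := φ ::ₘ Γ) (by simp) hp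
      have h₂ := ih₂ (Θ := Θ) (Γ := ψ ::ₘ Γ) (by simp) hp
      refine ⟨fun hδ => ?_, ?_⟩
      · exact exInterp_left_of_mem
          (mem_conjuncts_of_eLeft (χ := .or (exInterp p (φ ::ₘ Γ)) (exInterp p (ψ ::ₘ Γ)))
            (by simp [eLeft]))
          (.orL _ _ _ _ (h₁.1 hδ) (h₂.1 hδ))
      · exact allInterp_right_of_mem (mem_disjuncts_of_aLeft (by simp [aLeft]))
          (.andR _ _ _ (h₁.imp_right.weaken _) (h₂.imp_right.weaken _))
  | orR1 S φ ψ _ ih =>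
    refine ⟨fun h => ?_, allInterp_right_of_mem
      (mem_disjuncts_of_aRight (by simp [aRight])) (ih hS hp).2⟩
    simp only [vars, Set.mem_union, not_or] at h
    exact .orR1 _ _ _ ((ih hS hp).1 h.1)
  | orR2 S φ ψ _ ih =>
    refine ⟨fun h => ?_, allInterp_right_of_mem
      (mem_disjuncts_of_aRight (by simp [aRight])) (ih hS hp).2⟩
    simp only [vars, Set.mem_union, not_or] at h
    exact .orR2 _ _ _ ((ih hS hp).1 h.2)
  | impR S φ ψ _ ih =>
    subst hS
    refine ⟨fun h => ?_, ?_⟩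
    · simp only [vars, Set.mem_union, not_or] at h
      exact .impR _ _ _ ((ih (Θ := φ ::ₘ Θ) (Γ := Γ) (by simp) (by simp_all)).1 h.2).swap
    · exact allInterp_right_of_mem (mem_disjuncts_of_aRight (by simp [aRight]))
        ((ih (Θ := Θ) (Γ := φ ::ₘ Γ) (by simp) hp).imp_right.weaken _)
  | andImpL S φ ψ χ δ _ ih =>
    rcases Multiset.cons_eq_add hS with ⟨Θ, rfl, rfl⟩ | ⟨Γ, rfl, rfl⟩
    · exact (ih (Θ := φ.imp (ψ.imp χ) ::ₘ Θ) (Γ := Γ) (by simp)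
        (by simp_all [vars])).map fun τ h => (G4CK.andImpL _ _ _ _ _ h.swap).swap
    · exact (ih (Γ := φ.imp (ψ.imp χ) ::ₘ Γ) (by simp) hp).of_mem
        (mem_conjuncts_of_eLeft (by simp [eLeft])) (mem_disjuncts_of_aLeft (by simp [aLeft]))
  | orImpL S φ ψ χ δ _ ih =>
    rcases Multiset.cons_eq_add hS with ⟨Θ, rfl, rfl⟩ | ⟨Γ, rfl, rfl⟩
    · refine (ih (Θ := φ.imp χ ::ₘ ψ.imp χ ::ₘ Θ) (Γ := Γ) (by simp)
        (by simp_all [vars])).map fun τ h => ?_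
      exact (G4CK.orImpL (exInterp p Γ ::ₘ Θ) φ ψ χ τ h.of_count_le).swap
    · exact (ih (Γ := φ.imp χ ::ₘ ψ.imp χ ::ₘ Γ) (by simp) hp).of_mem
        (mem_conjuncts_of_eLeft (by simp [eLeft])) (mem_disjuncts_of_aLeft (by simp [aLeft]))
  | pImpL S n φ δ _ ih =>
    rcases Multiset.cons_eq_add hS with ⟨Θ, rfl, hS'⟩ | ⟨Γ, rfl, hS'⟩ <;>
      rcases Multiset.cons_eq_add hS' with ⟨Θ, rfl, rfl⟩ | ⟨Γ, rfl, rfl⟩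
    · refine (ih (Θ := .var n ::ₘ φ ::ₘ Θ) (Γ := Γ) (by simp)
        (by simp_all [vars])).map fun τ h => ?_
      exact (G4CK.pImpL (exInterp p Γ ::ₘ Θ) n φ τ h.of_count_le).of_count_le
    · have hn : n ≠ p := by rintro rfl; simp [vars] at hp
      exact (ih (Γ := φ ::ₘ Γ) (by simp [Multiset.cons_swap]) hp).of_imp_mem (χ := .var n)
        (mem_conjuncts_of_eLeft (by simp [eLeft, hn]))
        (mem_disjuncts_of_aLeft (by simp [aLeft, hn])) (.idP _ _)
    · have hn : n ≠ p := by rintro rfl; simp [vars] at hp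
      refine (ih (Θ := φ ::ₘ Θ) (Γ := .var n ::ₘ Γ) (by simp)
        (by simp_all [vars])).map fun τ h => ?_
      have hE := mem_conjuncts_of_eLeft (p := p) (φ := .var n) (χ := .var n) (Γ := Γ)
        (by simp [eLeft, hn])
      rw [exInterp_left_iff] at h ⊢
      obtain ⟨C, hC⟩ := Multiset.exists_cons_of_mem hE
      rw [hC] at h ⊢
      exact (G4CK.pImpL (C + Form.top ::ₘ Θ) n φ τ h.of_count_le).of_count_le
    · have h := ih (Θ := Θ) (Γ := φ ::ₘ .var n ::ₘ Γ) (by simp [Multiset.cons_swap]) hp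
      by_cases hn : n = p
      · subst hn
        rw [Multiset.cons_swap]
        exact h.of_mem
          (mem_conjuncts_of_eLeft (by simp [eLeft])) (mem_disjuncts_of_aLeft (by simp [aLeft]))
      · have hvar : .var n ∈ conjuncts p (exInterp p) (allInterp p)
            (.var n ::ₘ (Form.var n).imp φ ::ₘ Γ) :=
          mem_conjuncts_of_eLeft (by simp [eLeft, hn])
        have himp : (Form.var n).imp (exInterp p (φ ::ₘ .var n ::ₘ Γ)) ∈
            conjuncts p (exInterp p) (allInterp p) (.var n ::ₘ (Form.var n).imp φ ::ₘ Γ) := by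
          rw [Multiset.cons_swap]
          exact mem_conjuncts_of_eLeft (by simp [eLeft, hn])
        have hE {τ} (h : G4CK (exInterp p (φ ::ₘ .var n ::ₘ Γ) ::ₘ Θ) τ) :
            G4CK (exInterp p (.var n ::ₘ (Form.var n).imp φ ::ₘ Γ) ::ₘ Θ) τ := by
          refine exInterp_left_of_le (M := {.var n, (Form.var n).imp _})
            ((Multiset.cons_le_of_notMem ?_).2 ⟨hvar, Multiset.singleton_le.2 himp⟩) ?_
          · simp
          · simpa using G4CK.pImpL _ _ _ _ (h.weaken _)
        refine ⟨fun hδ => hE (h.1 hδ), ?_⟩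
        refine allInterp_right_of_mem (χ := .and (.var n) (allInterp p (φ ::ₘ .var n ::ₘ Γ) δ)) ?_
          (.andR _ _ _ (exInterp_left_of_mem hvar (.idP _ _)) (hE h.2))
        rw [Multiset.cons_swap]
        exact mem_disjuncts_of_aLeft (by simp [aLeft, hn])
  | impImpL S φ ψ χ δ _ _ ih₁ ih₂ =>
    rcases Multiset.cons_eq_add hS with ⟨Θ, rfl, rfl⟩ | ⟨Γ, rfl, rfl⟩
    · have h₁ := (ih₁ (Θ := ψ.imp χ ::ₘ Θ) (Γ := Γ) (by simp) (by simp_all [vars])).1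
        (by simp_all [vars])
      exact (ih₂ (Θ := χ ::ₘ Θ) (Γ := Γ) (by simp) (by simp_all [vars])).map
        fun τ h => (G4CK.impImpL _ _ _ _ _ h₁.swap h.swap).swap
    · have h₁ := ih₁ (Θ := Θ) (Γ := ψ.imp χ ::ₘ Γ) (by simp) hp
      exact (ih₂ (Γ := χ ::ₘ Γ) (by simp) hp).of_imp_mem
        (mem_conjuncts_of_eLeft (by simp [eLeft]))
        (mem_disjuncts_of_aLeft (by simp [aLeft])) h₁.imp_right
  | boxR S φ hφ ih =>
    subst hS
    have h := ih (Θ := boxInv Θ) (Γ := boxInv Γ) (by simp) (hb _ hp)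
    refine ⟨fun hδ => ?_, allInterp_right_of_mem (mem_disjuncts_of_aRight (by simp [aRight]))
      ((G4CK.boxR _ _ h.imp_right).weaken _)⟩
    rw [exInterp_left_iff]
    exact .boxR _ _ ((conjuncts_boxInv_left (by simpa using hφ) (h.1 hδ)).perm
      (by simp [add_comm]))
  | boxImpL S φ ψ δ hφ _ ih₁ ih₂ =>
    rcases Multiset.cons_eq_add hS with ⟨Θ, rfl, rfl⟩ | ⟨Γ, rfl, rfl⟩
    · have h := (ih₁ (Θ := boxInv Θ) (Γ := boxInv Γ) (by simp)
        (hb _ (by simp_all [vars]))).1 (by simp_all [vars])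
      have h₁ := conjuncts_boxInv_left (by simpa using hφ) h
      refine (ih₂ (Θ := ψ ::ₘ Θ) (Γ := Γ) (by simp) (by simp_all [vars])).map fun τ h₂ => ?_
      rw [exInterp_left_iff] at h₂ ⊢
      exact (G4CK.boxImpL (conjuncts p (exInterp p) (allInterp p) Γ + Form.top ::ₘ Θ) φ ψ τ
        h₁.of_count_le h₂.of_count_le).of_count_le
    · have h₁ := ih₁ (Θ := boxInv Θ) (Γ := boxInv Γ) (by simp) (hb _ hp)
      exact (ih₂ (Γ := ψ ::ₘ Γ) (by simp) hp).of_imp_mem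
        (mem_conjuncts_of_eLeft (by simp [eLeft]))
        (mem_disjuncts_of_aLeft (by simp [aLeft])) (.boxR _ _ h₁.imp_right)
  | diaImpL S γ φ ψ δ hφ _ ih₁ ih₂ =>
    rcases Multiset.cons_eq_add hS with ⟨Θ, rfl, hS'⟩ | ⟨Γ, rfl, hS'⟩ <;>
      rcases Multiset.cons_eq_add hS' with ⟨Θ, rfl, rfl⟩ | ⟨Γ, rfl, rfl⟩ <;>
      clear hS hS' <;>
      try simp only [varsM_cons, vars, Set.mem_union, not_or] at hp
    · have h := (ih₁ (Θ := γ ::ₘ boxInv Θ) (Γ := boxInv Γ) (by simp)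
        (by simp [hp, hb])).1 (by simp [hp])
      have h₁ := conjuncts_boxInv_left (by simpa using hφ) h
      refine (ih₂ (Θ := ψ ::ₘ γ.dia ::ₘ Θ) (Γ := Γ) (by simp)
        (by simp [vars, hp])).map fun τ h₂ => ?_
      rw [exInterp_left_iff] at h₂ ⊢
      exact (G4CK.diaImpL (conjuncts p (exInterp p) (allInterp p) Γ + Form.top ::ₘ Θ) γ φ ψ τ
        h₁.of_count_le h₂.of_count_le).of_count_le
    · have h₁ := (ih₁ (Θ := boxInv Θ) (Γ := γ ::ₘ boxInv Γ) (by simp)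
        (hb _ hp.2)).1 hp.1.1
      refine (ih₂ (Θ := ψ ::ₘ Θ) (Γ := γ.dia ::ₘ Γ) (by simp [Multiset.cons_swap])
        (by simp [hp])).map fun τ h₂ => ?_
      have hE := mem_conjuncts_of_eLeft (p := p) (φ := γ.dia) (Γ := Γ)
        (χ := .dia (exInterp p (γ ::ₘ boxInv Γ))) (by simp [eLeft])
      rw [exInterp_left_iff] at h₂ ⊢
      obtain ⟨C, hC⟩ := Multiset.exists_cons_of_mem hE
      rw [hC] at h₂ ⊢
      exact (G4CK.diaImpL (C + Form.top ::ₘ Θ) (exInterp p (γ ::ₘ boxInv Γ)) φ ψ τ h₁.of_count_le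
        h₂.of_count_le).of_count_le
    · have h₁ := ih₁ (Θ := γ ::ₘ boxInv Θ) (Γ := boxInv Γ) (by simp) (by simp [hp, hb])
      exact (ih₂ (Θ := γ.dia ::ₘ Θ) (Γ := ψ ::ₘ Γ) (by simp)
        (by simp [vars, hp])).of_imp_mem
        (mem_conjuncts_of_eLeft (Multiset.mem_cons_self _ _))
        (mem_disjuncts_of_aLeft (Multiset.mem_cons_self _ _)) (.diaL _ _ _ h₁.imp_right)
    · have h₁ := ih₁ (Θ := boxInv Θ) (Γ := γ ::ₘ boxInv Γ) (by simp) (hb _ hp)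
      have hγ : γ ∈ diaPart (γ.dia ::ₘ Γ) := mem_diaPart.2 (by simp)
      exact (ih₂ (Γ := ψ ::ₘ γ.dia ::ₘ Γ) (by simp) hp).of_imp_mem
        (mem_conjuncts_of_eLeft (Multiset.mem_cons_of_mem
          (Multiset.mem_map_of_mem (fun γ' => Form.imp _ _) hγ)))
        (mem_disjuncts_of_aLeft (Multiset.mem_cons_of_mem
          (Multiset.mem_map_of_mem (fun γ' => Form.and _ _) hγ)))
        (.boxR _ _ (by simpa using h₁.imp_right))
  | diaL S φ ψ hψ ih =>
    rcases Multiset.cons_eq_add hS with ⟨Θ, rfl, rfl⟩ | ⟨Γ, rfl, rfl⟩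
    · have h := ih (Θ := φ ::ₘ boxInv Θ) (Γ := boxInv Γ) (by simp) (by simp_all [vars])
      refine ⟨fun hδ => ?_, allInterp_right_of_mem
        (mem_disjuncts_of_aRight (Multiset.mem_cons_self _ _))
        ((G4CK.diaL _ _ _ h.imp_right).weaken _)⟩
      have h₁ := conjuncts_boxInv_left (by simpa using hψ) (h.1 hδ)
      rw [exInterp_left_iff]
      exact (G4CK.diaL (conjuncts p (exInterp p) (allInterp p) Γ + Form.top ::ₘ Θ) φ ψ
        h₁.of_count_le).of_count_le
    · have h := ih (Θ := boxInv Θ) (Γ := φ ::ₘ boxInv Γ) (by simp) (hb _ hp)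
      have hφ : φ ∈ diaPart (φ.dia ::ₘ Γ) := mem_diaPart.2 (by simp)
      refine ⟨fun hδ => ?_, ?_⟩
      · exact exInterp_left_of_mem (mem_conjuncts_of_eLeft (Multiset.mem_singleton_self _))
          (.diaL _ _ _ (h.1 hδ))
      · exact allInterp_right_of_mem (mem_disjuncts_of_aRight (Multiset.mem_cons_of_mem
          (Multiset.mem_map_of_mem (fun γ => Form.box _) hφ)))
          ((G4CK.boxR _ _ (by simpa using h.imp_right)).weaken _)

end UnifInterp

/-- The sequent calculus G4CK has the uniform interpolation property:
there are formulas `E p Γ` and `A p Γ δ` satisfying p-freeness,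
implication and uniformity. -/
theorem G4CK_uniform_interpolation :
    ∃ (E : ℕ → Multiset Form → Form) (A : ℕ → Multiset Form → Form → Form),
      ∀ (p : ℕ) (Γ : Multiset Form) (δ : Form),
        -- (1) p-freeness
        vars (E p Γ) ⊆ varsM Γ \ {p} ∧
        vars (A p Γ δ) ⊆ (varsM Γ ∪ vars δ) \ {p} ∧
        -- (2) implication
        G4CK Γ (E p Γ) ∧
        G4CK (A p Γ δ ::ₘ Γ) δ ∧
        -- (3) uniformity
        (∀ Θ : Multiset Form, p ∉ varsM Θ → G4CK (Θ + Γ) δ →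
          (p ∉ vars δ → G4CK (E p Γ ::ₘ Θ) δ) ∧
          G4CK (E p Γ ::ₘ Θ) (A p Γ δ)) := by
  refine ⟨UnifInterp.exInterp, UnifInterp.allInterp, fun p Γ δ => ?_⟩
  obtain ⟨hE, hE'⟩ := UnifInterp.isSound_interp p (Γ, none)
  obtain ⟨hA, hA'⟩ := UnifInterp.isSound_interp p (Γ, some δ)
  exact ⟨hE, hA, hE', hA', fun Θ hp h => UnifInterp.uniform_of_derivable h rfl hp⟩
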